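/- Let D ⊆ ℂ be a domain, let A be a closed polar subset of D, and let f be holomorphic on D \ A. Assume that f does not extend holomorphically to any point of A, i.e., for every a ∈ A there is no open neighborhood V ⊆ D of a and holomorphic function g on V with g = f on V \ A. Let A' be the set of accumulation points of A that lie in D. Then the set Γ_f ∪ (A' × ℂ) is complete pluripolar in D × ℂ. -/

import Mathlib

open Set Metric MeasureTheory Filter Topology

noncomputable section

open Classical in
/-- The average of an `EReal`-valued function over the circle of center `z` and radius `r`;
it is `⊥` if the function equals `⊥` on a set of positive measure of the circle or if
its (finite) values are not integrable over the circle. -/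
def circleAvg (u : ℂ → EReal) (z : ℂ) (r : ℝ) : EReal :=
  if (IntervalIntegrable (fun θ : ℝ => (u (circleMap z r θ)).toReal) volume 0 (2 * Real.pi)
      ∧ ∀ᵐ θ ∂(volume.restrict (Set.Ioc (0:ℝ) (2 * Real.pi))), u (circleMap z r θ) ≠ ⊥)
  then (((∫ θ in (0:ℝ)..(2 * Real.pi), (u (circleMap z r θ)).toReal) / (2 * Real.pi) : ℝ) : EReal)
  else ⊥

/-- `u` is plurisubharmonic on a (typically open) set `Ω` of a complex vector space:
it takes values in `[-∞, ∞)`, is upper semicontinuous on `Ω`, is not identically `-∞`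
on any connected component of `Ω`, and its restriction to every complex line satisfies
the sub-mean value inequality on circles (whose closed discs lie in `Ω`). -/
def PSHOn {E : Type*} [NormedAddCommGroup E] [NormedSpace ℂ E]
    (u : E → EReal) (Ω : Set E) : Prop :=
  (∀ z ∈ Ω, u z ≠ ⊤) ∧
  UpperSemicontinuousOn u Ω ∧
  (∀ z ∈ Ω, ∃ w ∈ connectedComponentIn Ω z, u w ≠ ⊥) ∧
  ∀ a b : E, ∀ c : ℂ, ∀ r : ℝ, 0 < r →
    (∀ l ∈ Metric.closedBall c r, a + l • b ∈ Ω) →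
    u (a + c • b) ≤ circleAvg (fun l : ℂ => u (a + l • b)) c r

/-- In one complex variable, plurisubharmonic = subharmonic. -/
abbrev SubharmonicOn (u : ℂ → EReal) (Ω : Set ℂ) : Prop := PSHOn u Ω

/-- A set `P ⊆ ℂ` is polar if `P ⊆ {u = -∞}` for some subharmonic `u` on `ℂ`
(not identically `-∞`). -/
def PolarSet (P : Set ℂ) : Prop :=
  ∃ u : ℂ → EReal, SubharmonicOn u Set.univ ∧ ∀ z ∈ P, u z = ⊥

/-- `S` is pluripolar in `Ω`. -/
def PluripolarIn {E : Type*} [NormedAddCommGroup E] [NormedSpace ℂ E]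
    (S Ω : Set E) : Prop :=
  ∃ u : E → EReal, PSHOn u Ω ∧ ∀ z ∈ S, u z = ⊥

/-- `S` is complete pluripolar in `Ω`: `S` is exactly the `-∞`-set of some
plurisubharmonic function on `Ω`. -/
def CompletePluripolarIn {E : Type*} [NormedAddCommGroup E] [NormedSpace ℂ E]
    (S Ω : Set E) : Prop :=
  ∃ u : E → EReal, PSHOn u Ω ∧ ∀ z ∈ Ω, (u z = ⊥ ↔ z ∈ S)

/-- The pluripolar hull `S*_Ω` of `S` in `Ω`. -/
def pluripolarHull {E : Type*} [NormedAddCommGroup E] [NormedSpace ℂ E]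
    (S Ω : Set E) : Set E :=
  {z ∈ Ω | ∀ u : E → EReal, PSHOn u Ω → (∀ w ∈ S, u w = ⊥) → u z = ⊥}

/-- `S` is (pluri-)thin at `ζ`: either `ζ` is not a limit point of `S \ {ζ}`, or there is
a plurisubharmonic function on a neighborhood of `ζ` with
`limsup_{z → ζ, z ∈ S \ {ζ}} u z < u ζ`. -/
def PluriThinAt {E : Type*} [NormedAddCommGroup E] [NormedSpace ℂ E]
    (S : Set E) (ζ : E) : Prop :=
  ζ ∉ closure (S \ {ζ}) ∨
  ∃ U : Set E, IsOpen U ∧ ζ ∈ U ∧ ∃ u : E → EReal, PSHOn u U ∧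
    Filter.limsup u (nhdsWithin ζ (S \ {ζ})) < u ζ

/-- Thinness in `ℂ`. -/
abbrev ThinAt (S : Set ℂ) (ζ : ℂ) : Prop := PluriThinAt S ζ

/-- The relative extremal function (pluriharmonic measure) `ω(z, A, D)`:
`-sup { u(z) : u` psh on `D`, `u ≤ 0` on `D`, `u ≤ -1` on `A }`, where for points of `A`
not belonging to `D` the condition `u ≤ -1` is understood as
`limsup_{ζ → w, ζ ∈ D} u(ζ) ≤ -1` (for `w ∈ A ∩ D` and `u` upper semicontinuous the
condition below is equivalent to `u w ≤ -1`). -/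
def relExtremal {E : Type*} [NormedAddCommGroup E] [NormedSpace ℂ E]
    (z : E) (A D : Set E) : EReal :=
  - sSup {y : EReal | ∃ u : E → EReal, PSHOn u D ∧ (∀ w ∈ D, u w ≤ 0) ∧
      (∀ w ∈ A, Filter.limsup u (nhdsWithin w (insert w D)) ≤ -1) ∧ y = u z}

/-- `ζ` is a regular boundary point of `Ω` if `ζ ∈ ∂Ω` and `ℂ \ Ω` is non-thin at `ζ`. -/
def RegularBoundaryPoint (Ω : Set ℂ) (ζ : ℂ) : Prop :=
  ζ ∈ frontier Ω ∧ ¬ ThinAt Ωᶜ ζ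

/-- The graph `Γ_f = {(z, f z) : z ∈ S} ⊆ ℂ²` of `f` over `S`. -/
def graphOver (f : ℂ → ℂ) (S : Set ℂ) : Set (ℂ × ℂ) := {p | p.1 ∈ S ∧ p.2 = f p.1}

/-- `e^x` for `x ∈ [-∞, ∞)`, as a map to `[0, ∞)`. -/
def expEReal (x : EReal) : ℝ := if x = ⊥ then 0 else Real.exp x.toReal

end


/-- Local plurisubharmonicity of a real function at a point. -/
structure GoodAt {E : Type*} [NormedAddCommGroup E] [NormedSpace ℂ E]
    (F : E → ℝ) (p : E) : Prop where
  usc : UpperSemicontinuousAt F p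
  bdd : ∃ m : ℝ, ∀ᶠ y in 𝓝 p, m ≤ F y
  smv : ∀ b : E, ∀ᶠ r in 𝓝[>] (0:ℝ), CircleIntegrable (fun l : ℂ => F (p + l • b)) 0 r ∧
    F p ≤ Real.circleAverage (fun l : ℂ => F (p + l • b)) 0 r

section good
variable {E : Type*} [NormedAddCommGroup E] [NormedSpace ℂ E]

lemma eventually_line {Q : E → Prop} {p : E} (h : ∀ᶠ y in 𝓝 p, Q y) (b : E) :
    ∀ᶠ r in 𝓝[>] (0:ℝ), 0 < r ∧ ∀ l ∈ closedBall (0:ℂ) r, Q (p + l • b) := by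
  have hc : Tendsto (fun l : ℂ => p + l • b) (𝓝 0) (𝓝 p) := by
    have : Continuous (fun l : ℂ => p + l • b) := by fun_prop
    simpa using this.tendsto 0
  obtain ⟨ε, he, hb⟩ := Metric.eventually_nhds_iff_ball.1 (hc.eventually h)
  have : Ioo (0:ℝ) ε ∈ 𝓝[>] (0:ℝ) := Ioo_mem_nhdsGT he
  filter_upwards [this] with r hr
  refine ⟨hr.1, fun l hl => hb l ?_⟩
  rw [mem_closedBall] at hl
  rw [mem_ball]; linarith [hr.2]

lemma sphere_abs_sub {r : ℝ} (hr : 0 < r) {l : ℂ} (hl : l ∈ sphere (0:ℂ) |r|) :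
    l ∈ closedBall (0:ℂ) r := by
  rw [abs_of_pos hr] at hl
  exact sphere_subset_closedBall hl

lemma circleIntegrable_congr' {f g : ℂ → ℝ} {r : ℝ} (hr : 0 < r)
    (h : ∀ l ∈ closedBall (0:ℂ) r, f l = g l) (hf : CircleIntegrable f 0 r) :
    CircleIntegrable g 0 r := by
  have : (fun θ : ℝ => f (circleMap 0 r θ)) = fun θ => g (circleMap 0 r θ) := by
    funext θ
    exact h _ (sphere_subset_closedBall (circleMap_mem_sphere 0 hr.le θ))
  unfold CircleIntegrable at *
  rw [← this]; exact hf

lemma usc_congr {α : Type*} [TopologicalSpace α] {F G : α → ℝ} {p : α} (h : UpperSemicontinuousAt F p) (e : F =ᶠ[𝓝 p] G) :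
    UpperSemicontinuousAt G p := by
  rw [upperSemicontinuousAt_iff] at *
  intro y hy
  rw [← e.self_of_nhds] at hy
  filter_upwards [h y hy, e] with x hx he
  rwa [← he]

lemma GoodAt.congr {F G : E → ℝ} {p : E} (h : GoodAt F p) (e : F =ᶠ[𝓝 p] G) : GoodAt G p := by
  refine ⟨usc_congr h.usc e, ?_, fun b => ?_⟩
  · obtain ⟨m, hm⟩ := h.bdd
    refine ⟨m, ?_⟩
    filter_upwards [hm, e] with y h1 h2
    rwa [← h2]
  · filter_upwards [h.smv b, eventually_line e b] with r h1 h2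
    have e2 : ∀ l ∈ closedBall (0:ℂ) r, F (p + l • b) = G (p + l • b) := fun l hl => h2.2 l hl
    refine ⟨circleIntegrable_congr' h2.1 e2 h1.1, ?_⟩
    rw [← e.self_of_nhds, ← Real.circleAverage_congr_sphere
      (fun l hl => e2 l (sphere_abs_sub h2.1 hl))]
    exact h1.2

lemma circleIntegrable_max {f g : ℂ → ℝ} {r : ℝ} {c : ℂ} (hf : CircleIntegrable f c r)
    (hg : CircleIntegrable g c r) : CircleIntegrable (fun l => max (f l) (g l)) c r := by
  unfold CircleIntegrable at *
  rw [intervalIntegrable_iff] at *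
  exact Integrable.sup hf hg

lemma GoodAt.max {F G : E → ℝ} {p : E} (hF : GoodAt F p) (hG : GoodAt G p) :
    GoodAt (fun y => max (F y) (G y)) p := by
  refine ⟨hF.usc.sup hG.usc, ?_, fun b => ?_⟩
  · obtain ⟨m, hm⟩ := hF.bdd
    exact ⟨m, hm.mono fun y hy => hy.trans (le_max_left _ _)⟩
  · filter_upwards [hF.smv b, hG.smv b] with r h1 h2
    have hi := circleIntegrable_max h1.1 h2.1
    refine ⟨hi, max_le (h1.2.trans ?_) (h2.2.trans ?_)⟩
    · exact Real.circleAverage_mono h1.1 hi fun _ _ => le_max_left _ _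
    · exact Real.circleAverage_mono h2.1 hi fun _ _ => le_max_right _ _

lemma GoodAt.add {F G : E → ℝ} {p : E} (hF : GoodAt F p) (hG : GoodAt G p) :
    GoodAt (fun y => F y + G y) p := by
  refine ⟨hF.usc.add hG.usc, ?_, fun b => ?_⟩
  · obtain ⟨m, hm⟩ := hF.bdd
    obtain ⟨m', hm'⟩ := hG.bdd
    refine ⟨m + m', ?_⟩
    filter_upwards [hm, hm'] with y h1 h2
    exact add_le_add h1 h2
  · filter_upwards [hF.smv b, hG.smv b] with r h1 h2
    refine ⟨h1.1.add h2.1, ?_⟩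
    rw [Real.circleAverage_fun_add h1.1 h2.1]
    exact add_le_add h1.2 h2.2

lemma GoodAt.const (c : ℝ) (p : E) : GoodAt (fun _ : E => c) p := by
  refine ⟨upperSemicontinuousAt_const, ⟨c, by simp⟩, fun b => ?_⟩
  filter_upwards with r
  refine ⟨circleIntegrable_const _ _ _, ?_⟩
  rw [Real.circleAverage_const]

lemma GoodAt.const_mul {F : E → ℝ} {p : E} (hF : GoodAt F p) {c : ℝ} (hc : 0 ≤ c) :
    GoodAt (fun y => c * F y) p := by
  refine ⟨?_, ?_, fun b => ?_⟩
  · have : Continuous (fun x : ℝ => c * x) := by fun_prop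
    exact this.continuousAt.comp_upperSemicontinuousAt hF.usc
      (fun x y h => mul_le_mul_of_nonneg_left h hc)
  · obtain ⟨m, hm⟩ := hF.bdd
    exact ⟨c * m, hm.mono fun y hy => mul_le_mul_of_nonneg_left hy hc⟩
  · filter_upwards [hF.smv b] with r h1
    have h2 : CircleIntegrable (fun l : ℂ => c * F (p + l • b)) 0 r := by
      exact h1.1.const_mul c
    refine ⟨h2, ?_⟩
    have := Real.circleAverage_fun_smul (a := c) (f := fun l : ℂ => F (p + l • b)) (c := 0) (R := r)
    simp only [smul_eq_mul] at this
    rw [this]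
    exact mul_le_mul_of_nonneg_left h1.2 hc

lemma GoodAt.sum {ι : Type*} (s : Finset ι) {F : ι → E → ℝ} {p : E}
    (h : ∀ i ∈ s, GoodAt (F i) p) : GoodAt (fun y => ∑ i ∈ s, F i y) p := by
  classical
  induction s using Finset.induction_on with
  | empty => simpa using GoodAt.const 0 p
  | insert a s ha ih =>
    simp only [Finset.sum_insert ha]
    exact (h a (by simp)).add (ih fun i hi => h i (by simp [hi]))

/-- usc near `p` and locally bounded gives integrability on small circles -/
lemma circleIntegrable_of_usc {F : E → ℝ} {p : E}
    (h : ∀ᶠ y in 𝓝 p, UpperSemicontinuousAt F y) (hb : ∃ m : ℝ, ∀ᶠ y in 𝓝 p, m ≤ F y) (b : E) :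
    ∀ᶠ r in 𝓝[>] (0:ℝ), CircleIntegrable (fun l : ℂ => F (p + l • b)) 0 r := by
  obtain ⟨m, hm⟩ := hb
  have hM : ∀ᶠ y in 𝓝 p, F y < F p + 1 :=
    upperSemicontinuousAt_iff.1 h.self_of_nhds _ (by linarith)
  filter_upwards [eventually_line (h.and (hm.and hM)) b] with r hr
  have hmem : ∀ θ, circleMap 0 r θ ∈ closedBall (0:ℂ) r := fun θ =>
    sphere_subset_closedBall (circleMap_mem_sphere 0 hr.1.le θ)
  have hmeas : Measurable (fun θ : ℝ => F (p + circleMap 0 r θ • b)) := by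
    apply UpperSemicontinuous.measurable
    intro θ
    have hc : Continuous (fun θ : ℝ => p + circleMap 0 r θ • b) := by fun_prop
    exact UpperSemicontinuousAt.comp (f := F) (g := fun θ : ℝ => p + circleMap 0 r θ • b)
      (hr.2 _ (hmem θ)).1 hc.continuousAt
  unfold CircleIntegrable
  rw [intervalIntegrable_iff]
  refine Measure.integrableOn_of_bounded (M := max |m| |F p + 1|) 
    (by rw [uIoc]; exact measure_Ioc_lt_top.ne) hmeas.aestronglyMeasurable ?_
  filter_upwards with θ
  rw [Real.norm_eq_abs]
  have := hr.2 _ (hmem θ)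
  exact abs_le_max_abs_abs this.2.1 this.2.2.le

lemma goodAt_of_le {F G : E → ℝ} {p : E} (h : ∀ᶠ y in 𝓝 p, UpperSemicontinuousAt F y)
    (hb : ∃ m : ℝ, ∀ᶠ y in 𝓝 p, m ≤ F y) (hG : GoodAt G p) (hle : ∀ᶠ y in 𝓝 p, G y ≤ F y)
    (he : F p = G p) : GoodAt F p := by
  refine ⟨h.self_of_nhds, hb, fun b => ?_⟩
  filter_upwards [circleIntegrable_of_usc h hb b, hG.smv b, eventually_line hle b] with r h1 h2 h3
  refine ⟨h1, ?_⟩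
  rw [he]
  refine h2.2.trans (Real.circleAverage_mono h2.1 h1 fun x hx => ?_)
  exact h3.2 x (sphere_abs_sub h3.1 hx)

lemma bdd_of_continuousAt {F : E → ℝ} {p : E} (h : ContinuousAt F p) :
    ∃ m : ℝ, ∀ᶠ y in 𝓝 p, m ≤ F y :=
  ⟨F p - 1, (h.eventually (lt_mem_nhds (by linarith : F p - 1 < F p))).mono fun _ h => h.le⟩

lemma line_differentiable {h : E → ℂ} {p b : E} {r : ℝ}
    (hd : ∀ l ∈ closedBall (0:ℂ) r, ∀ᶠ y in 𝓝 (p + l • b), DifferentiableAt ℂ h y) :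
    AnalyticOnNhd ℂ (fun l : ℂ => h (p + l • b)) (closedBall 0 r) := by
  intro l hl
  have hc : Continuous (fun l : ℂ => p + l • b) := by fun_prop
  have := (hc.tendsto l).eventually (hd l hl)
  rw [Complex.analyticAt_iff_eventually_differentiableAt]
  filter_upwards [this] with z hz
  exact hz.comp z (by fun_prop)

lemma goodAt_log_norm {h : E → ℂ} {p : E} (hd : ∀ᶠ y in 𝓝 p, DifferentiableAt ℂ h y)
    (h0 : h p ≠ 0) : GoodAt (fun y => Real.log ‖h y‖) p := by
  have hc : ContinuousAt h p := hd.self_of_nhds.continuousAt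
  have hne : ∀ᶠ y in 𝓝 p, h y ≠ 0 := hc.eventually_ne h0
  have hcc : ∀ᶠ y in 𝓝 p, ContinuousAt (fun y => Real.log ‖h y‖) y := by
    filter_upwards [hd, hne] with y h1 h2
    exact (h1.continuousAt.norm).log (by simpa using h2)
  refine ⟨hcc.self_of_nhds.upperSemicontinuousAt, bdd_of_continuousAt hcc.self_of_nhds, fun b => ?_⟩
  filter_upwards [eventually_line (hd.eventually_nhds.and hne) b,
    circleIntegrable_of_usc (hcc.mono fun y hy => hy.upperSemicontinuousAt)
      (bdd_of_continuousAt hcc.self_of_nhds) b] with r hr hi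
  refine ⟨hi, ?_⟩
  have h1 := line_differentiable (h := h) (p := p) (b := b) (r := |r|)
    (by rw [abs_of_pos hr.1]; exact fun l hl => (hr.2 l hl).1)
  have h2 := h1.circleAverage_log_norm_of_ne_zero
    (by rw [abs_of_pos hr.1]; exact fun l hl => (hr.2 l hl).2)
  simp only [zero_smul, add_zero] at h2
  rw [h2]

lemma goodAt_log_max {h : E → ℂ} {p : E} (hd : ∀ᶠ y in 𝓝 p, DifferentiableAt ℂ h y)
    {k : ℝ} (hk : 0 < k) : GoodAt (fun y => Real.log (max ‖h y‖ k)) p := by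
  have hcc : ∀ᶠ y in 𝓝 p, ContinuousAt (fun y => Real.log (max ‖h y‖ k)) y := by
    filter_upwards [hd] with y h1
    have : ContinuousAt (fun y => max ‖h y‖ k) y := h1.continuousAt.norm.max continuousAt_const
    exact this.log (lt_max_of_lt_right hk).ne'
  have hu := hcc.mono fun y hy => hy.upperSemicontinuousAt
  have hb := bdd_of_continuousAt hcc.self_of_nhds
  by_cases hp : ‖h p‖ ≤ k
  · refine goodAt_of_le hu hb (GoodAt.const (Real.log k) p) ?_ (by simp [hp])
    filter_upwards with y
    exact Real.log_le_log hk (le_max_right _ _)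
  · push Not at hp
    refine (goodAt_log_norm hd (by intro h0; simp [h0] at hp; linarith)).congr ?_
    have := hd.self_of_nhds.continuousAt.norm.eventually (lt_mem_nhds hp)
    filter_upwards [this] with y hy
    rw [max_eq_left hy.le]

lemma goodAt_norm {h : E → ℂ} {p : E} (hd : ∀ᶠ y in 𝓝 p, DifferentiableAt ℂ h y) :
    GoodAt (fun y => ‖h y‖) p := by
  have hcc : ∀ᶠ y in 𝓝 p, ContinuousAt (fun y => ‖h y‖) y := by
    filter_upwards [hd] with y h1
    exact h1.continuousAt.norm
  have hu := hcc.mono fun y hy => hy.upperSemicontinuousAt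
  have hb := bdd_of_continuousAt hcc.self_of_nhds
  refine ⟨hu.self_of_nhds, hb, fun b => ?_⟩
  filter_upwards [eventually_line hd.eventually_nhds b, circleIntegrable_of_usc hu hb b] with r hr hi
  refine ⟨hi, ?_⟩
  have h1 := line_differentiable (h := h) (p := p) (b := b) (r := |r|)
    (by rw [abs_of_pos hr.1]; exact fun l hl => (hr.2 l hl))
  have h2 : Real.circleAverage (fun l : ℂ => h (p + l • b)) 0 r = h (p + (0:ℂ) • b) := by
    apply DiffContOnCl.circleAverage
    exact (h1.differentiableOn.mono closure_ball_subset_closedBall).diffContOnCl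
  simp only [zero_smul, add_zero] at h2
  rw [← h2, Real.circleAverage, Real.circleAverage, norm_smul, smul_eq_mul, Real.norm_of_nonneg (by positivity)]
  gcongr
  exact intervalIntegral.norm_integral_le_integral_norm (by positivity)

lemma GoodAt.comp_fst {q : ℂ → ℝ} {p : ℂ × ℂ} (h : GoodAt q p.1) :
    GoodAt (fun x : ℂ × ℂ => q x.1) p := by
  refine ⟨h.usc.comp continuousAt_fst, ?_, fun b => ?_⟩
  · obtain ⟨m, hm⟩ := h.bdd
    exact ⟨m, continuousAt_fst.eventually hm⟩
  · exact h.smv b.1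

lemma GoodAt.comp_line {F : E → ℝ} {a b : E} {l : ℂ} (h : GoodAt F (a + l • b)) :
    GoodAt (fun l : ℂ => F (a + l • b)) l := by
  have hc : Continuous (fun l : ℂ => a + l • b) := by fun_prop
  refine ⟨UpperSemicontinuousAt.comp (f := F) (g := fun l : ℂ => a + l • b) h.usc hc.continuousAt,
    ?_, fun b' => ?_⟩
  · obtain ⟨m, hm⟩ := h.bdd
    exact ⟨m, hc.continuousAt.eventually hm⟩
  · have := h.smv (b' • b)
    have e : ∀ ζ : ℂ, a + (l + ζ • b') • b = a + l • b + ζ • (b' • b) := by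
      intro ζ
      rw [add_smul, smul_assoc, add_assoc]
    simp only [e]
    exact this

end good

lemma circleIntegrable_of_continuous {E : Type*} [NormedAddCommGroup E] {g : ℂ → E} (h : Continuous g) (c : ℂ) (r : ℝ) :
    CircleIntegrable g c r := by
  unfold CircleIntegrable
  have : Continuous (fun θ : ℝ => g (circleMap c r θ)) := by fun_prop
  exact this.intervalIntegrable _ _

lemma avg_re_holo {h : ℂ → ℂ} (hd : Differentiable ℂ h) (z : ℂ) (r : ℝ) :
    Real.circleAverage (fun y => (h y).re) z r = (h z).re := by
  have h1 : Real.circleAverage h z r = h z := by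
    apply DiffContOnCl.circleAverage
    exact hd.diffContOnCl
  have h2 := Complex.reCLM.circleAverage_comp_comm
    (circleIntegrable_of_continuous hd.continuous z r)
  rw [h1] at h2
  exact h2

lemma avg_norm_sq (z : ℂ) (r : ℝ) :
    Real.circleAverage (fun y : ℂ => ‖y‖ ^ 2) z r = ‖z‖ ^ 2 + r ^ 2 := by
  have h1 : ∀ y ∈ sphere z |r|, ‖y‖ ^ 2 =
      (((starRingEnd ℂ) z * (2 * (y - z)) + ((‖z‖ ^ 2 + r ^ 2 : ℝ) : ℂ)) : ℂ).re := by
    intro y hy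
    have h2 : ‖y - z‖ ^ 2 = r ^ 2 := by
      rw [mem_sphere_iff_norm] at hy; rw [hy, sq_abs]
    rw [Complex.sq_norm, Complex.normSq_apply] at *
    rw [Complex.sq_norm, Complex.normSq_apply]
    simp only [Complex.sub_re, Complex.sub_im] at h2
    simp only [Complex.add_re, Complex.mul_re, Complex.conj_re, Complex.conj_im, Complex.ofReal_re,
      Complex.re_ofNat, Complex.im_ofNat, Complex.sub_re, Complex.sub_im, Complex.mul_im]
    nlinarith
  rw [Real.circleAverage_congr_sphere h1, avg_re_holo (by fun_prop)]
  simp only [sub_self, mul_zero, zero_add, Complex.ofReal_re]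

lemma max_principle {K : Set ℂ} (hK : IsCompact K) {ψ : ℂ → ℝ} (hu : UpperSemicontinuousOn ψ K)
    (h : ∀ z ∈ K, ψ z ≤ 0 ∨ ∀ᶠ r in 𝓝[>] (0:ℝ), CircleIntegrable ψ z r ∧
      ψ z ≤ Real.circleAverage ψ z r ∧ ∀ y ∈ sphere z r, y ∈ K ∨ ψ y ≤ 0) :
    ∀ z ∈ K, ψ z ≤ 0 := by
  by_contra! hcon
  obtain ⟨z0, hz0, hm⟩ := hcon
  obtain ⟨R, hR0, hR⟩ := hK.isBounded.exists_pos_norm_le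
  set m := ψ z0 with hmdef
  set ε := m / (2 * (R + 1) ^ 2) with hε
  have hε0 : 0 < ε := by positivity
  have hεR : ε * (R + 1) ^ 2 = m / 2 := by rw [hε]; field_simp
  set g : ℂ → ℝ := fun z => ψ z + ε * ‖z‖ ^ 2 with hg
  have hgc : Continuous (fun z : ℂ => ε * ‖z‖ ^ 2) := by fun_prop
  have hgu : UpperSemicontinuousOn g K := hu.add (hgc.upperSemicontinuous.upperSemicontinuousOn K)
  obtain ⟨zs, hzs, hmax⟩ := hgu.exists_isMaxOn ⟨z0, hz0⟩ hK
  have h1 : m ≤ g zs := by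
    have := hmax hz0
    simp only [mem_ofPred_eq, hg] at this
    simp only [hg]
    nlinarith [sq_nonneg ‖z0‖]
  have h2 : 0 < ψ zs := by
    have : ‖zs‖ ^ 2 ≤ (R + 1) ^ 2 := by
      have := hR zs hzs
      gcongr; linarith
    simp only [hg] at h1
    nlinarith
  rcases h zs hzs with h3 | h3
  · linarith
  have h4 : Ioo (0:ℝ) 1 ∈ 𝓝[>] (0:ℝ) := Ioo_mem_nhdsGT one_pos
  obtain ⟨r, ⟨hi, hav, hs⟩, hr⟩ := (h3.and (eventually_of_mem h4 fun _ hx => hx)).exists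
  have hgi : CircleIntegrable g zs r := hi.add (circleIntegrable_of_continuous hgc zs r)
  have h5 : Real.circleAverage g zs r ≤ g zs := by
    apply Real.circleAverage_mono_on_of_le_circle hgi
    intro y hy
    rw [abs_of_pos hr.1] at hy
    rcases hs y hy with h6 | h6
    · exact hmax h6
    · refine le_trans ?_ h1
      have : ‖y‖ ≤ R + 1 := by
        have e1 : ‖y - zs‖ = r := by simpa [dist_eq_norm] using hy
        have := norm_le_norm_add_norm_sub' y zs
        linarith [hR zs hzs, hr.2]
      have : ‖y‖ ^ 2 ≤ (R + 1) ^ 2 := by gcongr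
      simp only [hg]; nlinarith
  have h6 : Real.circleAverage g zs r = Real.circleAverage ψ zs r + ε * (‖zs‖ ^ 2 + r ^ 2) := by
    rw [hg, Real.circleAverage_fun_add hi (circleIntegrable_of_continuous hgc zs r)]
    congr 1
    have := Real.circleAverage_fun_smul (a := ε) (f := fun l : ℂ => ‖l‖ ^ 2) (c := zs) (R := r)
    simp only [smul_eq_mul] at this
    rw [this, avg_norm_sq]
  rw [h6] at h5
  simp only [hg] at h5
  have : 0 < ε * r ^ 2 := by have := hr.1; positivity
  linarith

instance fact_two_pi : Fact ((0:ℝ) < 2 * Real.pi) := ⟨Real.two_pi_pos⟩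

lemma trig_approx (g : C(AddCircle (2 * Real.pi), ℝ)) {ε : ℝ} (hε : 0 < ε) :
    ∃ H : ℂ → ℂ, Differentiable ℂ H ∧ ∀ θ : ℝ,
      |g (θ : AddCircle (2 * Real.pi)) - (H (Complex.exp (θ * Complex.I))).re| < ε := by
  set G : C(AddCircle (2 * Real.pi), ℂ) := ⟨fun x => (g x : ℂ), by fun_prop⟩ with hG
  have hmem : G ∈ (Submodule.span ℂ (range (@fourier (2 * Real.pi)))).topologicalClosure := by
    rw [span_fourier_closure_eq_top]; trivial
  rw [← SetLike.mem_coe, Submodule.topologicalClosure_coe, Metric.mem_closure_iff] at hmem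
  obtain ⟨h, hh, hd⟩ := hmem ε hε
  have key : ∀ h ∈ Submodule.span ℂ (range (@fourier (2 * Real.pi))), ∃ H1 H2 : ℂ → ℂ,
      Differentiable ℂ H1 ∧ Differentiable ℂ H2 ∧ ∀ θ : ℝ, h (θ : AddCircle (2 * Real.pi)) =
        H1 (Complex.exp (θ * Complex.I)) + (starRingEnd ℂ) (H2 (Complex.exp (θ * Complex.I))) := by
    intro h hh
    induction hh using Submodule.span_induction with
    | mem x hx =>
      obtain ⟨n, rfl⟩ := hx
      rcases Int.eq_nat_or_neg n with ⟨k, rfl | rfl⟩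
      · refine ⟨fun z => z ^ k, fun _ => 0, by fun_prop, by fun_prop, fun θ => ?_⟩
        rw [fourier_coe_apply]
        simp only [map_zero, add_zero]
        rw [← Complex.exp_nat_mul]
        congr 1
        have := Real.pi_ne_zero
        push_cast
        field_simp
      · refine ⟨fun _ => 0, fun z => z ^ k, by fun_prop, by fun_prop, fun θ => ?_⟩
        rw [fourier_coe_apply]
        simp only [zero_add]
        rw [← Complex.exp_nat_mul, ← Complex.exp_conj]
        congr 1
        have := Real.pi_ne_zero
        simp only [map_mul, Complex.conj_I, Complex.conj_ofReal, map_natCast]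
        push_cast
        field_simp
    | zero => exact ⟨fun _ => 0, fun _ => 0, by fun_prop, by fun_prop, fun θ => by simp⟩
    | add x y _ _ hx hy =>
      obtain ⟨a, b, ha, hb, hab⟩ := hx
      obtain ⟨a', b', ha', hb', hab'⟩ := hy
      refine ⟨fun z => a z + a' z, fun z => b z + b' z, by fun_prop, by fun_prop, fun θ => ?_⟩
      rw [ContinuousMap.add_apply, hab, hab', map_add]; ring
    | smul c x _ hx =>
      obtain ⟨a, b, ha, hb, hab⟩ := hx
      refine ⟨fun z => c * a z, fun z => (starRingEnd ℂ) c * b z, by fun_prop, by fun_prop,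
        fun θ => ?_⟩
      rw [ContinuousMap.smul_apply, hab, map_mul, smul_eq_mul, Complex.conj_conj]; ring
  obtain ⟨H1, H2, hd1, hd2, he⟩ := key h hh
  refine ⟨fun z => H1 z + H2 z, by fun_prop, fun θ => ?_⟩
  have h1 : (H1 (Complex.exp (θ * Complex.I)) + H2 (Complex.exp (θ * Complex.I))).re
      = (h (θ : AddCircle (2 * Real.pi))).re := by
    rw [he]; simp
  rw [h1]
  have h2 : ‖(G - h) (θ : AddCircle (2 * Real.pi))‖ ≤ ‖G - h‖ := ContinuousMap.norm_coe_le_norm _ _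
  rw [dist_eq_norm] at hd
  have h3 := Complex.abs_re_le_norm ((G - h) (θ : AddCircle (2 * Real.pi)))
  have h4 : ((G - h) (θ : AddCircle (2 * Real.pi))).re = g (θ : AddCircle (2 * Real.pi)) - (h (θ : AddCircle (2 * Real.pi))).re := by
    simp [hG]
  rw [h4] at h3
  linarith

lemma usc_approx {X : Type*} [MetricSpace X] {φ : X → ℝ} (hu : UpperSemicontinuous φ)
    {m M : ℝ} (hm : ∀ x, m ≤ φ x) (hM : ∀ x, φ x ≤ M) :
    ∃ g : ℕ → C(X, ℝ), (∀ k x, φ x ≤ g k x ∧ g k x ≤ M) ∧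
      ∀ x, Tendsto (fun k => g k x) atTop (𝓝 (φ x)) := by
  have hbd : ∀ (k : ℕ) x, BddAbove (range fun y => φ y - k * dist x y) := fun k x =>
    ⟨M, by rintro _ ⟨y, rfl⟩; have := hM y; have : 0 ≤ (k:ℝ) * dist x y := by positivity
           simp only; linarith⟩
  have hlip : ∀ k : ℕ, LipschitzWith k (fun x => ⨆ y, (φ y - k * dist x y)) := by
    intro k
    apply LipschitzWith.of_le_add_mul
    intro x x'
    have : Nonempty X := ⟨x⟩
    apply ciSup_le
    intro y
    have h1 := le_ciSup (hbd k x') y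
    have h2 := dist_triangle x' x y
    have h3 : (k:ℝ) * dist x' y ≤ k * (dist x x' + dist x y) := by
      rw [dist_comm x x']; gcongr
    push_cast
    linarith
  refine ⟨fun k => ⟨_, (hlip k).continuous⟩, fun k x => ⟨?_, ?_⟩, fun x => ?_⟩
  · have := le_ciSup (hbd k x) x
    simpa using this
  · have : Nonempty X := ⟨x⟩
    apply ciSup_le
    intro y
    have := hM y; have : 0 ≤ (k:ℝ) * dist x y := by positivity
    linarith
  · have : Nonempty X := ⟨x⟩
    rw [Metric.tendsto_atTop]
    intro ε hε
    have h1 := upperSemicontinuousAt_iff.1 (hu x) (φ x + ε / 2) (by linarith)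
    obtain ⟨δ, hδ, hb⟩ := Metric.eventually_nhds_iff.1 h1
    obtain ⟨N, hN⟩ := exists_nat_gt ((M - m) / δ)
    refine ⟨N, fun k hk => ?_⟩
    have hle : (⨆ y, (φ y - k * dist x y)) ≤ φ x + ε / 2 := by
      apply ciSup_le
      intro y
      by_cases hy : dist y x < δ
      · have := hb hy
        have : 0 ≤ (k:ℝ) * dist x y := by positivity
        linarith
      · push Not at hy
        rw [dist_comm] at hy
        have h2 : (M - m) ≤ N * δ := by
          rw [div_lt_iff₀ hδ] at hN; exact hN.le
        have h3 : (N:ℝ) * δ ≤ k * dist x y := by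
          have : (N:ℝ) ≤ k := by exact_mod_cast hk
          gcongr
        linarith [hM y, hm x]
    have hge : φ x ≤ ⨆ y, (φ y - k * dist x y) := by
      have := le_ciSup (hbd k x) x
      simpa using this
    simp only [ContinuousMap.coe_mk]
    rw [Real.dist_eq, abs_lt]
    constructor <;> linarith

lemma goodAt_avg {φ : ℂ → ℝ} {z : ℂ} (h : GoodAt φ z) : ∀ᶠ r in 𝓝[>] (0:ℝ),
    CircleIntegrable φ z r ∧ φ z ≤ Real.circleAverage φ z r := by
  filter_upwards [h.smv 1] with r hr
  have e : ∀ θ, z + circleMap 0 r θ = circleMap z r θ := by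
    intro θ; simp [circleMap]
  refine ⟨?_, ?_⟩
  · have := hr.1
    unfold CircleIntegrable at *
    simp only [smul_eq_mul, mul_one, e] at this
    exact this
  · have := hr.2
    unfold Real.circleAverage at *
    simp only [smul_eq_mul, mul_one, e] at this
    exact this

lemma exists_lower_bound {K : Set ℂ} (hK : IsCompact K) {φ : ℂ → ℝ}
    (h : ∀ z ∈ K, ∃ m : ℝ, ∀ᶠ y in 𝓝 z, m ≤ φ y) : ∃ m : ℝ, ∀ z ∈ K, m ≤ φ z := by
  refine hK.induction_on (p := fun s => ∃ m : ℝ, ∀ z ∈ s, m ≤ φ z) ⟨0, by simp⟩ ?_ ?_ ?_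
  · rintro s t hst ⟨m, hm⟩
    exact ⟨m, fun z hz => hm z (hst hz)⟩
  · rintro s t ⟨m, hm⟩ ⟨m', hm'⟩
    refine ⟨min m m', fun z hz => ?_⟩
    rcases hz with hz | hz
    · exact (min_le_left _ _).trans (hm z hz)
    · exact (min_le_right _ _).trans (hm' z hz)
  · intro z hz
    obtain ⟨m, hm⟩ := h z hz
    exact ⟨_, mem_nhdsWithin_of_mem_nhds hm, m, fun z hz => hz⟩

/-- local to global for submean value inequality -/
lemma local_to_global {φ : ℂ → ℝ} {c : ℂ} {r : ℝ} (hr : 0 < r)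
    (h : ∀ z ∈ closedBall c r, GoodAt φ z) :
    CircleIntegrable φ c r ∧ φ c ≤ Real.circleAverage φ c r := by
  have husc : UpperSemicontinuousOn φ (closedBall c r) := fun z hz =>
    (h z hz).usc.upperSemicontinuousWithinAt _
  have hcK := isCompact_closedBall c r
  obtain ⟨m, hm⟩ := exists_lower_bound hcK (fun z hz => (h z hz).bdd)
  obtain ⟨zM, hzM, hM⟩ := husc.exists_isMaxOn ⟨c, mem_closedBall_self hr.le⟩ hcK
  set M := φ zM
  have hmem : ∀ θ, circleMap c r θ ∈ closedBall c r := fun θ =>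
    sphere_subset_closedBall (circleMap_mem_sphere c hr.le θ)
  -- function on the additive circle
  set e : AddCircle (2 * Real.pi) → ℂ := fun x => c + r * (AddCircle.toCircle x : ℂ) with he
  have hec : Continuous e := by
    have := AddCircle.continuous_toCircle (T := 2 * Real.pi)
    fun_prop
  have heθ : ∀ θ : ℝ, e (θ : AddCircle (2 * Real.pi)) = circleMap c r θ := by
    intro θ
    simp only [he, circleMap, AddCircle.toCircle_apply_mk, Circle.coe_exp]
    have := Real.pi_ne_zero
    congr 3
    push_cast
    field_simp
  have hemem : ∀ x, e x ∈ closedBall c r := by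
    intro x
    have : ‖(AddCircle.toCircle x : ℂ)‖ = 1 := Circle.norm_coe _
    simp [he, abs_of_pos hr, this]
  have hΦu : UpperSemicontinuous (fun x => φ (e x)) := fun x =>
    UpperSemicontinuousAt.comp (f := φ) (g := e) (h _ (hemem x)).usc hec.continuousAt
  obtain ⟨g, hg1, hg2⟩ := usc_approx hΦu (m := m) (M := M) (fun x => hm _ (hemem x))
    (fun x => hM (hemem x))
  have hmeas : Measurable (fun θ : ℝ => φ (circleMap c r θ)) := by
    apply UpperSemicontinuous.measurable
    intro θ
    have hc : Continuous (fun θ : ℝ => circleMap c r θ) := by fun_prop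
    exact UpperSemicontinuousAt.comp (f := φ) (g := fun θ : ℝ => circleMap c r θ)
      (h _ (hmem θ)).usc hc.continuousAt
  have hIntg : CircleIntegrable φ c r := by
    unfold CircleIntegrable
    rw [intervalIntegrable_iff]
    refine Measure.integrableOn_of_bounded (M := max |m| |M|)
      (by rw [uIoc]; exact measure_Ioc_lt_top.ne) hmeas.aestronglyMeasurable ?_
    filter_upwards with θ
    rw [Real.norm_eq_abs]
    exact abs_le_max_abs_abs (hm _ (hmem θ)) (hM (hmem θ))
  refine ⟨hIntg, ?_⟩
  have hgc : ∀ k, Continuous (fun θ : ℝ => g k (θ : AddCircle (2 * Real.pi))) := fun k =>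
    (g k).continuous.comp (AddCircle.continuous_mk' _)
  have hstep : ∀ k : ℕ, φ c ≤ (2 * Real.pi)⁻¹ * (∫ θ in (0:ℝ)..(2 * Real.pi),
      g k (θ : AddCircle (2 * Real.pi))) + 2 / ((k:ℝ) + 1) := by
    intro k
    set ε : ℝ := 1 / ((k:ℝ) + 1) with hε
    have hε0 : 0 < ε := by positivity
    obtain ⟨H, hH, hap⟩ := trig_approx (g k) hε0
    set H' : ℂ → ℂ := fun z => H ((z - c) / r) with hH'
    have hd : Differentiable ℂ H' := by
      apply hH.comp; fun_prop
    have hH'θ : ∀ θ : ℝ, H' (circleMap c r θ) = H (Complex.exp (θ * Complex.I)) := by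
      intro θ
      simp only [hH', circleMap]
      congr 1
      have : (r:ℂ) ≠ 0 := by exact_mod_cast hr.ne'
      field_simp
      ring
    have hHc : Continuous (fun z => -(H' z).re - ε) := by
      have := hd.continuous
      fun_prop
    have hmp : ∀ z ∈ closedBall c r, φ z + (-(H' z).re - ε) ≤ 0 := by
      apply max_principle hcK (ψ := fun z => φ z + (-(H' z).re - ε))
      · exact husc.add (hHc.upperSemicontinuous.upperSemicontinuousOn _)
      · intro z hz
        by_cases hzs : z ∈ sphere c r
        · left
          have : z ∈ range (circleMap c r) := by rwa [range_circleMap, abs_of_pos hr]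
          obtain ⟨θ, rfl⟩ := this
          have h1 := (hg1 k (θ : AddCircle (2 * Real.pi))).1
          rw [heθ] at h1
          have h2 := abs_lt.1 (hap θ)
          rw [hH'θ]
          linarith
        · right
          have hzb : z ∈ ball c r := by
            rw [← closedBall_sdiff_sphere]; exact ⟨hz, hzs⟩
          have hev : ∀ᶠ y in 𝓝 z, y ∈ ball c r := isOpen_ball.mem_nhds hzb
          have h0 := eventually_line hev (1:ℂ)
          filter_upwards [goodAt_avg (h z hz), h0] with s hs hs0
          refine ⟨hs.1.add (circleIntegrable_of_continuous hHc z s), ?_, ?_⟩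
          · rw [Real.circleAverage_fun_add hs.1 (circleIntegrable_of_continuous hHc z s)]
            have e1 : Real.circleAverage (fun z => -(H' z).re - ε) z s = -(H' z).re - ε := by
              have := avg_re_holo (h := fun z => - H' z - (ε:ℂ)) (by fun_prop) z s
              simpa using this
            rw [e1]
            linarith [hs.2]
          · intro y hy
            left
            apply ball_subset_closedBall
            have := hs0.2 (y - z) (by
              rw [mem_closedBall_zero_iff]
              rw [mem_sphere_iff_norm] at hy
              exact hy.le)
            simpa using this
    have h1 := hmp c (mem_closedBall_self hr.le)
    have h2 := avg_re_holo hd c r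
    have h3 : (H' c).re ≤ (2 * Real.pi)⁻¹ * (∫ θ in (0:ℝ)..(2 * Real.pi),
      (g k (θ : AddCircle (2 * Real.pi)) + ε)) := by
      rw [← h2, Real.circleAverage, smul_eq_mul]
      have := Real.pi_pos
      gcongr
      apply intervalIntegral.integral_mono_on (by positivity)
      · have : Continuous (fun θ : ℝ => (H' (circleMap c r θ)).re) := by
          have := hd.continuous
          fun_prop
        exact this.intervalIntegrable _ _
      · have : Continuous (fun θ : ℝ => g k (θ : AddCircle (2 * Real.pi)) + ε) := by
          have := hgc k
          fun_prop
        exact this.intervalIntegrable _ _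
      · intro θ _
        rw [hH'θ]
        linarith [abs_lt.1 (hap θ)]
    rw [intervalIntegral.integral_add ((hgc k).intervalIntegrable _ _)
      (by simp)] at h3
    simp only [intervalIntegral.integral_const, sub_zero, smul_eq_mul, mul_add] at h3
    have h4 : (2 * Real.pi)⁻¹ * (2 * Real.pi * ε) = ε := by
      have := Real.pi_ne_zero
      field_simp
    rw [h4] at h3
    have h5 : 2 / ((k:ℝ) + 1) = ε + ε := by rw [hε]; ring
    rw [h5]
    linarith
  have hlim : Tendsto (fun k : ℕ => (2 * Real.pi)⁻¹ * (∫ θ in (0:ℝ)..(2 * Real.pi),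
      g k (θ : AddCircle (2 * Real.pi))) + 2 / ((k:ℝ) + 1)) atTop
      (𝓝 ((2 * Real.pi)⁻¹ * (∫ θ in (0:ℝ)..(2 * Real.pi), φ (circleMap c r θ)) + 0)) := by
    apply Tendsto.add
    · apply Tendsto.const_mul
      apply intervalIntegral.tendsto_integral_filter_of_dominated_convergence
        (fun _ => max |m| |M|)
      · exact Eventually.of_forall fun k => (hgc k).aestronglyMeasurable
      · refine Eventually.of_forall fun k => Eventually.of_forall fun θ _ => ?_
        rw [Real.norm_eq_abs]
        have := hg1 k (θ : AddCircle (2 * Real.pi))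
        exact abs_le_max_abs_abs ((hm _ (hemem _)).trans this.1) this.2
      · simp
      · refine Eventually.of_forall fun θ _ => ?_
        have := hg2 (θ : AddCircle (2 * Real.pi))
        rwa [heθ] at this
    · have := tendsto_one_div_add_atTop_nhds_zero_nat (𝕜 := ℝ)
      have := this.const_mul 2
      simpa [div_eq_mul_inv] using this
  have := ge_of_tendsto' hlim hstep
  simpa [Real.circleAverage] using this

lemma selection (a : ℂ) {d : ℝ} {O : Set ℂ} (hO : IsOpen O)
    (hmeet : ∀ s ∈ Icc (d / 2) d, ∃ z ∈ O, dist z a = s) (hd : 0 < d) :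
    ∃ (P : Set ℂ) (p : ℝ → ℂ), IsCompact P ∧ P ⊆ O ∧ Measurable p ∧
      ∀ s ∈ Icc (d / 2) d, p s ∈ P ∧ dist (p s) a = s := by
  have key := (isCompact_Icc (a := d / 2) (b := d)).induction_on
    (p := fun S => ∃ (T : Set ℝ) (P : Set ℂ) (p : ℝ → ℂ), S ⊆ T ∧ MeasurableSet T ∧ IsCompact P ∧
      P ⊆ O ∧ Measurable p ∧ ∀ s ∈ T ∩ Icc (d / 2) d, p s ∈ P ∧ dist (p s) a = s)
    ⟨∅, ∅, fun _ => 0, by simp, by simp, by simp, by simp, by fun_prop, by simp⟩ ?_ ?_ ?_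
  · obtain ⟨T, P, p, h1, h2, h3, h4, h5, h6⟩ := key
    exact ⟨P, p, h3, h4, h5, fun s hs => h6 s ⟨h1 hs, hs⟩⟩
  · rintro s t hst ⟨T, P, p, h1, h2⟩
    exact ⟨T, P, p, hst.trans h1, h2⟩
  · rintro s t ⟨T, P, p, h1, h2, h3, h4, h5, h6⟩ ⟨T', P', p', h1', h2', h3', h4', h5', h6'⟩
    classical
    refine ⟨T ∪ T', P ∪ P', T.piecewise p p', union_subset_union h1 h1', h2.union h2',
      h3.union h3', union_subset h4 h4', h5.piecewise h2 h5', ?_⟩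
    rintro x ⟨hx, hxI⟩
    by_cases hxT : x ∈ T
    · rw [piecewise_eq_of_mem _ _ _ hxT]
      have := h6 x ⟨hxT, hxI⟩
      exact ⟨Or.inl this.1, this.2⟩
    · rw [piecewise_eq_of_notMem _ _ _ hxT]
      have := h6' x ⟨hx.resolve_left hxT, hxI⟩
      exact ⟨Or.inr this.1, this.2⟩
  · intro s hs
    obtain ⟨z, hz, hzs⟩ := hmeet s hs
    have hs0 : 0 < s := by linarith [hs.1]
    set e : ℝ → ℂ := fun t => a + (t / s : ℝ) * (z - a) with he
    have hec : Continuous e := by fun_prop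
    have hes : e s = z := by
      simp only [he]; rw [div_self hs0.ne']; simp
    have hmem : ∀ᶠ t in 𝓝 s, e t ∈ O := hec.continuousAt.eventually (by
      rw [hes]; exact hO.mem_nhds hz)
    obtain ⟨η, hη, hb⟩ := Metric.nhds_basis_closedBall.mem_iff.1 hmem
    refine ⟨closedBall s η, mem_nhdsWithin_of_mem_nhds (closedBall_mem_nhds s hη),
      closedBall s η, e '' closedBall s η, e, subset_rfl, measurableSet_closedBall,
      (isCompact_closedBall s η).image hec, ?_, hec.measurable, ?_⟩
    · rintro _ ⟨t, ht, rfl⟩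
      exact hb ht
    · rintro t ⟨ht, htI⟩
      refine ⟨⟨t, ht, rfl⟩, ?_⟩
      have ht0 : 0 < t := by linarith [htI.1]
      rw [dist_eq_norm] at hzs
      rw [dist_eq_norm]
      simp only [he, add_sub_cancel_left, norm_mul, hzs, Complex.norm_real]
      rw [Real.norm_of_nonneg (by positivity)]
      field_simp

lemma integrableOn_log_sub (t α β : ℝ) : IntegrableOn (fun s => Real.log (t - s)) (Ioc α β) := by
  by_cases h : α ≤ β
  · have := (intervalIntegral.intervalIntegrable_log' (a := t - α) (b := t - β)).comp_sub_left t
    simp only [sub_sub_cancel] at this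
    exact (intervalIntegrable_iff_integrableOn_Ioc_of_le h).1 this
  · rw [Ioc_eq_empty (by intro h'; exact h h'.le)]; simp

lemma log_int_bound (t : ℝ) {l : ℝ} (hl : 0 < l) :
    ∫ s in Ioc l (2 * l), -Real.log (t - s) ≤ 2 * l - l * Real.log l := by
  set h : ℝ → ℝ := fun s => Real.log l - Real.log (t - s) with hh
  set I := Ioc l (2 * l)
  set J := Ioc (t - l) (t + l)
  have hIntg : ∀ α β, IntegrableOn h (Ioc α β) := fun α β =>
    (integrableOn_const (by exact measure_Ioc_lt_top.ne)).sub (integrableOn_log_sub t α β)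
  have h1 : ∫ s in J, h s = 2 * l := by
    rw [← intervalIntegral.integral_of_le (by linarith)]
    have : IntervalIntegrable (fun s => Real.log (t - s)) volume (t - l) (t + l) :=
      (intervalIntegrable_iff_integrableOn_Ioc_of_le (by linarith)).2 (integrableOn_log_sub t _ _)
    rw [intervalIntegral.integral_sub (by simp) this,
      intervalIntegral.integral_comp_sub_left (fun x => Real.log x) t]
    simp only [sub_sub_cancel, intervalIntegral.integral_const, smul_eq_mul,
      sub_add_cancel_left, integral_log, Real.log_neg_eq_log]
    ring
  have h2 : ∫ s in I, h s = (∫ s in I ∩ J, h s) + ∫ s in I \ J, h s :=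
    (integral_inter_add_sdiff measurableSet_Ioc (hIntg _ _)).symm
  have h3 : ∫ s in I \ J, h s ≤ 0 := by
    apply setIntegral_nonpos (measurableSet_Ioc.diff measurableSet_Ioc)
    rintro s ⟨_, hs⟩
    simp only [hh]
    have : l ≤ |t - s| := by
      by_contra! hc
      rw [abs_lt] at hc
      exact hs ⟨by linarith, by linarith⟩
    rw [← Real.log_abs (t - s)]
    linarith [Real.log_le_log hl this]
  have h4 : ∫ s in I ∩ J, h s ≤ ∫ s in J, h s := by
    apply setIntegral_mono_set (hIntg _ _)
    · have hne : ∀ᵐ s : ℝ ∂(volume.restrict J), s ≠ t := by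
        apply ae_restrict_of_ae
        rw [ae_iff]; simp
      filter_upwards [ae_restrict_mem measurableSet_Ioc, hne] with s hs hst
      simp only [hh, Pi.zero_apply]
      have : |t - s| ≤ l := by
        rw [abs_le]; constructor <;> linarith [hs.1, hs.2]
      rw [← Real.log_abs (t - s)]
      have := Real.log_le_log (abs_pos.2 (sub_ne_zero.2 hst.symm)) this
      linarith
    · exact (inter_subset_right).eventuallyLE
  have h5 : ∫ s in I, h s = l * Real.log l + ∫ s in I, -Real.log (t - s) := by
    have e := integrableOn_log_sub t l (2 * l)
    have e0 : Integrable (fun _ : ℝ => Real.log l) (volume.restrict I) :=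
      integrableOn_const (by exact measure_Ioc_lt_top.ne)
    simp only [hh]
    rw [integral_sub e0 e, integral_neg]
    simp only [I]
    rw [setIntegral_const, Measure.real, Real.volume_Ioc, ENNReal.toReal_ofReal (by linarith), smul_eq_mul]
    ring
  linarith

lemma V_lemma (a : ℂ) {d : ℝ} (hd : 0 < d) {O : Set ℂ} (hO : IsOpen O)
    (hmeet : ∀ s ∈ Icc (d / 2) d, ∃ z ∈ O, dist z a = s) :
    ∃ (P : Set ℂ) (v : ℂ → ℝ), IsCompact P ∧ P ⊆ O ∧ (∀ z, v z ≤ Real.log (2 / d) + 2) ∧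
      (∀ z, z ∉ P → GoodAt v z) ∧ (∀ z, d < dist z a → v z ≤ -Real.log (dist z a - d)) ∧
      (∀ z, z ∉ P → -Real.log (dist z a + d) ≤ v z) := by
  obtain ⟨P, p, hP, hPO, hpm, hp⟩ := selection a hO hmeet hd
  set I := Ioc (d / 2) d with hI
  have hIv : volume.real I = d / 2 := by
    rw [Measure.real, Real.volume_Ioc, ENNReal.toReal_ofReal (by linarith)]; ring
  have hIfin : volume I ≠ ⊤ := measure_Ioc_lt_top.ne
  have hpI : ∀ s ∈ I, p s ∈ P ∧ dist (p s) a = s := fun s hs => hp s ⟨hs.1.le, hs.2⟩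
  set v : ℂ → ℝ := fun z => (2 / d) * ∫ s in I, -Real.log ‖z - p s‖ with hv
  have hmeas : ∀ z, Measurable (fun s => -Real.log ‖z - p s‖) := fun z => by fun_prop
  -- basic bounds
  have hup : ∀ z, ∀ s ∈ I, ‖z - p s‖ ≤ dist z a + d := fun z s hs => by
    rw [← dist_eq_norm]
    have := dist_triangle z a (p s)
    rw [dist_comm a, (hpI s hs).2] at this
    linarith [hs.2]
  have hlow : ∀ z, ∀ s ∈ I, |dist z a - s| ≤ ‖z - p s‖ := fun z s hs => by
    rw [← dist_eq_norm]
    have h1 := dist_triangle z (p s) a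
    have h2 := dist_triangle (p s) z a
    rw [(hpI s hs).2] at *
    rw [dist_comm (p s) z] at h2
    rw [abs_le]; constructor <;> linarith
  have hae : ∀ z, ∀ᵐ s ∂(volume.restrict I), -Real.log ‖z - p s‖ ≤ -Real.log (dist z a - s) ∧
      -Real.log (dist z a + d) ≤ -Real.log ‖z - p s‖ := by
    intro z
    have hne : ∀ᵐ s : ℝ ∂(volume.restrict I), s ≠ dist z a := by
      apply ae_restrict_of_ae
      rw [ae_iff]; simp
    filter_upwards [ae_restrict_mem measurableSet_Ioc, hne] with s hs hst
    have hpos : 0 < |dist z a - s| := abs_pos.2 (sub_ne_zero.2 hst.symm)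
    constructor
    · rw [← Real.log_abs (dist z a - s)]
      exact neg_le_neg (Real.log_le_log hpos (hlow z s hs))
    · exact neg_le_neg (Real.log_le_log (hpos.trans_le (hlow z s hs)) (hup z s hs))
  have hIntg : ∀ z, IntegrableOn (fun s => -Real.log ‖z - p s‖) I := by
    intro z
    refine Integrable.mono' (g := fun s => |Real.log (dist z a - s)| + |Real.log (dist z a + d)|)
      ?_ (hmeas z).aestronglyMeasurable ?_
    · exact (integrableOn_log_sub (dist z a) (d / 2) d).abs.add (integrableOn_const hIfin)
    · filter_upwards [hae z] with s hs
      rw [Real.norm_eq_abs, abs_le]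
      have h1 := neg_abs_le (Real.log (dist z a + d))
      have h2 := le_abs_self (Real.log (dist z a + d))
      have h3 := neg_abs_le (Real.log (dist z a - s))
      have h4 := le_abs_self (Real.log (dist z a - s))
      have h5 := abs_nonneg (Real.log (dist z a - s))
      have h6 := abs_nonneg (Real.log (dist z a + d))
      constructor <;> linarith [hs.1, hs.2]
  have hd2 : (0:ℝ) < 2 / d := by positivity
  refine ⟨P, v, hP, hPO, ?_, ?_, ?_, ?_⟩
  · intro z
    have h1 : ∫ s in I, -Real.log ‖z - p s‖ ≤ ∫ s in I, -Real.log (dist z a - s) :=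
      integral_mono_ae (hIntg z) (integrableOn_log_sub _ _ _).neg ((hae z).mono fun s hs => hs.1)
    have h2 := log_int_bound (dist z a) (l := d / 2) (by positivity)
    rw [show 2 * (d / 2) = d by ring] at h2
    have h3 : Real.log (2 / d) = - Real.log (d / 2) := by
      rw [← Real.log_inv, inv_div]
    simp only [hv]
    rw [h3]
    calc (2 / d) * _ ≤ (2 / d) * (d - d / 2 * Real.log (d / 2)) := by gcongr; linarith
      _ = _ := by field_simp; ring
  · intro z hz
    -- neighbourhood
    obtain ⟨η, hη, hηP⟩ : ∃ η > 0, ∀ y ∈ ball z η, ∀ x ∈ P, η ≤ ‖y - x‖ := by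
      obtain ⟨η, hη, hb⟩ := Metric.isOpen_iff.1 hP.isClosed.isOpen_compl z hz
      refine ⟨η / 2, by positivity, fun y hy x hx => ?_⟩
      by_contra! hc
      have : x ∈ ball z η := by
        rw [mem_ball] at *
        have := dist_triangle x y z
        rw [dist_comm x y, dist_eq_norm y x] at this
        linarith
      exact hb this hx
    set C := max |Real.log η| |Real.log (dist z a + η + d)| with hC
    have hbd : ∀ y ∈ ball z η, ∀ s ∈ I, ‖-Real.log ‖y - p s‖‖ ≤ C := by
      intro y hy s hs
      rw [norm_neg, Real.norm_eq_abs]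
      have h1 := hηP y hy _ (hpI s hs).1
      apply abs_le_max_abs_abs
      · exact Real.log_le_log hη h1
      · apply Real.log_le_log (hη.trans_le h1)
        have := hup y s hs
        have := dist_triangle y z a
        rw [mem_ball] at hy
        linarith
    have hcont : ∀ y ∈ ball z η, ContinuousAt v y := by
      intro y hy
      apply ContinuousAt.const_mul
      apply continuousAt_of_dominated (bound := fun _ => C)
      · exact Eventually.of_forall fun y => (hmeas y).aestronglyMeasurable
      · filter_upwards [isOpen_ball.mem_nhds hy] with y' hy'
        filter_upwards [ae_restrict_mem measurableSet_Ioc] with s hs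
        exact hbd y' hy' s hs
      · exact integrableOn_const hIfin
      · filter_upwards [ae_restrict_mem measurableSet_Ioc] with s hs
        have h1 := hηP y hy _ (hpI s hs).1
        have : ContinuousAt (fun x => ‖x - p s‖) y := by fun_prop
        exact (this.log (hη.trans_le h1).ne').neg
    have hball : ∀ᶠ y in 𝓝 z, y ∈ ball z η := ball_mem_nhds z hη
    have hu : ∀ᶠ y in 𝓝 z, UpperSemicontinuousAt v y := by
      filter_upwards [hball] with y hy
      exact (hcont y hy).upperSemicontinuousAt
    have hb := bdd_of_continuousAt (hcont z (mem_ball_self hη))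
    refine ⟨hu.self_of_nhds, hb, fun b => ?_⟩
    filter_upwards [circleIntegrable_of_usc hu hb b, eventually_line hball b] with r h1 h2
    refine ⟨h1, le_of_eq ?_⟩
    have hmem : ∀ θ, circleMap 0 r θ ∈ closedBall (0:ℂ) r := fun θ =>
      sphere_subset_closedBall (circleMap_mem_sphere 0 h2.1.le θ)
    have hinner : ∀ s ∈ I, ∫ θ in Ioc 0 (2 * Real.pi), -Real.log ‖z + circleMap 0 r θ • b - p s‖ =
        2 * Real.pi * -Real.log ‖z - p s‖ := by
      intro s hs
      have h3 := line_differentiable (h := fun y => y - p s) (p := z) (b := b) (r := |r|)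
        (fun l hl => Eventually.of_forall fun y => by fun_prop)
      have h4 := h3.circleAverage_log_norm_of_ne_zero (by
        rw [abs_of_pos h2.1]
        intro l hl h0
        have := hηP _ (h2.2 l hl) _ (hpI s hs).1
        rw [h0, norm_zero] at this
        linarith)
      simp only [zero_smul, add_zero] at h4
      rw [← h4, Real.circleAverage, intervalIntegral.integral_of_le (by positivity),
        integral_neg, smul_eq_mul]
      have := Real.pi_ne_zero
      field_simp
    rw [Real.circleAverage, intervalIntegral.integral_of_le (by positivity), smul_eq_mul]
    simp only [hv]
    rw [integral_const_mul, integral_integral_swap (f := fun θ s => -Real.log ‖z + circleMap 0 r θ • b - p s‖)]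
    · rw [setIntegral_congr_fun measurableSet_Ioc hinner, integral_const_mul]
      have := Real.pi_ne_zero
      rw [← hI]
      field_simp
    · have : IsFiniteMeasure ((volume.restrict (Ioc 0 (2 * Real.pi))).prod (volume.restrict I)) := by
        have : IsFiniteMeasure (volume.restrict I) := ⟨by simpa using measure_Ioc_lt_top⟩
        infer_instance
      refine Integrable.of_bound (C := C) (Measurable.aestronglyMeasurable ?_) ?_
      · simp only [Function.uncurry_def]
        fun_prop
      · rw [Measure.prod_restrict]
        filter_upwards [ae_restrict_mem (measurableSet_Ioc.prod measurableSet_Ioc)] with x hx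
        exact hbd _ (h2.2 _ (hmem x.1)) _ hx.2
  · intro z hz
    simp only [hv]
    have : ∫ s in I, -Real.log ‖z - p s‖ ≤ ∫ s in I, -Real.log (dist z a - d) := by
      apply setIntegral_mono_on (hIntg z) (integrableOn_const hIfin) measurableSet_Ioc
      intro s hs
      have h1 := (le_abs_self _).trans (hlow z s hs)
      exact neg_le_neg (Real.log_le_log (by linarith) (by linarith [hs.2]))
    rw [setIntegral_const, hIv, smul_eq_mul] at this
    calc (2 / d) * _ ≤ (2 / d) * (d / 2 * -Real.log (dist z a - d)) := by gcongr
      _ = _ := by field_simp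
  · intro z hz
    simp only [hv]
    have : ∫ s in I, -Real.log (dist z a + d) ≤ ∫ s in I, -Real.log ‖z - p s‖ := by
      have e0 : Integrable (fun _ : ℝ => -Real.log (dist z a + d)) (volume.restrict I) :=
        integrableOn_const hIfin
      apply integral_mono_ae e0 (hIntg z)
      exact (hae z).mono fun s hs => hs.2
    rw [setIntegral_const, hIv, smul_eq_mul] at this
    calc _ = (2 / d) * (d / 2 * -Real.log (dist z a + d)) := by field_simp
      _ ≤ _ := by gcongr

lemma trunc_coe {u : ℂ → EReal} (hu : ∀ z, u z ≠ ⊤) (T : ℝ) (z : ℂ) :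
    (((max (u z) ((-T : ℝ) : EReal)).toReal : ℝ) : EReal) = max (u z) ((-T : ℝ) : EReal) := by
  apply EReal.coe_toReal
  · intro h
    rcases max_choice (u z) ((-T : ℝ) : EReal) with h1 | h1
    · rw [h1] at h; exact hu z h
    · rw [h1] at h; exact EReal.coe_ne_top _ h
  · intro h
    have := le_max_right (u z) ((-T : ℝ) : EReal)
    rw [h, le_bot_iff] at this
    exact EReal.coe_ne_bot _ this

lemma trunc_usc {u : ℂ → EReal} (hu : ∀ z, u z ≠ ⊤) {z : ℂ} (hus : UpperSemicontinuousAt u z) (T : ℝ) :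
    UpperSemicontinuousAt (fun z => (max (u z) ((-T : ℝ) : EReal)).toReal) z := by
  rw [upperSemicontinuousAt_iff] at *
  intro y hy
  rw [← EReal.coe_lt_coe_iff, trunc_coe hu, max_lt_iff] at hy
  filter_upwards [hus y hy.1] with x hx
  rw [← EReal.coe_lt_coe_iff, trunc_coe hu, max_lt_iff]
  exact ⟨hx, hy.2⟩

lemma trunc_ge {u : ℂ → EReal} (hu : ∀ z, u z ≠ ⊤) (T : ℝ) (z : ℂ) :
    -T ≤ (max (u z) ((-T : ℝ) : EReal)).toReal := by
  rw [← EReal.coe_le_coe_iff, trunc_coe hu]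
  exact le_max_right _ _

lemma trunc_good {u : ℂ → EReal} (h : SubharmonicOn u univ) (T : ℝ) (z : ℂ) :
    GoodAt (fun z => (max (u z) ((-T : ℝ) : EReal)).toReal) z := by
  obtain ⟨h1, h2, h3, h4⟩ := h
  have hu : ∀ z, u z ≠ ⊤ := fun z => h1 z trivial
  have hus : ∀ z, UpperSemicontinuousAt u z := fun z => by
    have : UpperSemicontinuousWithinAt u univ z := h2 z trivial
    rwa [upperSemicontinuousWithinAt_univ_iff] at this
  have hev : ∀ᶠ y in 𝓝 z, UpperSemicontinuousAt (fun z => (max (u z) ((-T : ℝ) : EReal)).toReal) y :=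
    Eventually.of_forall fun y => trunc_usc hu (hus y) T
  have hb : ∃ m : ℝ, ∀ᶠ y in 𝓝 z, m ≤ (max (u y) ((-T : ℝ) : EReal)).toReal :=
    ⟨-T, Eventually.of_forall fun y => trunc_ge hu T y⟩
  by_cases hz : u z ≤ ((-T : ℝ) : EReal)
  · refine goodAt_of_le hev hb (GoodAt.const (-T) z) (Eventually.of_forall fun y => trunc_ge hu T y) ?_
    rw [max_eq_right hz, EReal.toReal_coe]
  push Not at hz
  refine ⟨hev.self_of_nhds, hb, fun b => ?_⟩
  filter_upwards [circleIntegrable_of_usc hev hb b, self_mem_nhdsWithin] with r hr hr0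
  refine ⟨hr, ?_⟩
  have h5 := h4 z b 0 r hr0 (fun _ _ => trivial)
  rw [zero_smul, add_zero] at h5
  have hzb : u z ≠ ⊥ := (lt_of_le_of_lt bot_le hz).ne'
  unfold circleAvg at h5
  split_ifs at h5 with h6
  · rw [← EReal.coe_le_coe_iff, trunc_coe hu, max_eq_left hz.le]
    refine h5.trans ?_
    rw [EReal.coe_le_coe_iff, Real.circleAverage, smul_eq_mul, div_eq_inv_mul]
    have := Real.pi_pos
    gcongr
    apply intervalIntegral.integral_mono_ae_restrict (by positivity) h6.1 hr
    have h7 := h6.2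
    rw [← restrict_Ioc_eq_restrict_Icc]
    filter_upwards [h7] with θ hθ
    rw [← EReal.coe_le_coe_iff, trunc_coe hu, EReal.coe_toReal (hu _) hθ]
    exact le_max_left _ _
  · exact absurd (le_bot_iff.1 h5) hzb

lemma component_small {g : ℂ → ℝ} (hg : ∀ z, GoodAt g z) {z1 a : ℂ} {ρ d m N : ℝ} (hρ : 0 < ρ)
    (hneg : ∀ z ∈ closedBall z1 (8 * ρ), g z ≤ 0) (hz1 : -m ≤ g z1) (hm : 0 < m)
    (ha : dist a z1 ≤ ρ) (hd : 0 < d) (hdρ : d ≤ ρ) (hN : m < N)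
    (hN2 : m * (Real.log (2 / d) + 2 + Real.log (6 * ρ)) < N * Real.log 3)
    (haN : g a < -N) :
    connectedComponentIn {z | g z < -N} a ⊆ ball a d := by
  have hΩ : IsOpen {z | g z < -N} := by
    rw [isOpen_iff_eventually]
    intro z hz
    exact upperSemicontinuousAt_iff.1 (hg z).usc _ hz
  set O := connectedComponentIn {z | g z < -N} a with hOdef
  have hO : IsOpen O := hΩ.connectedComponentIn
  have haO : a ∈ O := mem_connectedComponentIn haN
  have hOΩ : ∀ z ∈ O, g z < -N := fun z hz => by
    have : z ∈ {z | g z < -N} := connectedComponentIn_subset _ _ hz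
    exact this
  by_contra hcon
  obtain ⟨y, hyO, hyd⟩ := not_subset.1 hcon
  rw [mem_ball, not_lt] at hyd
  have hpre : IsPreconnected O := isPreconnected_connectedComponentIn
  have hmeet : ∀ s ∈ Icc (d / 2) d, ∃ z ∈ O, dist z a = s := by
    intro s hs
    have := hpre.intermediate_value haO hyO (f := fun z => dist z a) (by fun_prop)
    have hs' : s ∈ Icc (dist a a) (dist y a) := by
      rw [dist_self]; constructor <;> linarith [hs.1, hs.2]
    exact this hs'
  obtain ⟨P, v, hP, hPO, hv1, hv2, hv3, hv4⟩ := V_lemma a hd hO hmeet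
  set v0 := -Real.log (6 * ρ) with hv0
  have hL : 0 < Real.log (2 / d) + 2 - v0 := by
    have : Real.log (2 / d) + Real.log (6 * ρ) = Real.log (2 / d * (6 * ρ)) :=
      (Real.log_mul (by positivity) (by positivity)).symm
    have h2 : 0 ≤ Real.log (2 / d * (6 * ρ)) := by
      apply Real.log_nonneg
      rw [div_mul_eq_mul_div, le_div_iff₀ hd]; linarith
    linarith
  set t := N / (Real.log (2 / d) + 2 - v0) with ht
  have hN0 : 0 < N := hm.trans hN
  have ht0 : 0 < t := by positivity
  have htL : t * (Real.log (2 / d) + 2 - v0) = N := by rw [ht]; field_simp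
  have hz1O : z1 ∉ O := fun h => by linarith [hOΩ z1 h]
  have hgood : ∀ z, z ∉ O → GoodAt (fun z => g z + t * (v z + -v0)) z := fun z hz =>
    (hg z).add (((hv2 z fun h => hz (hPO h)).add (GoodAt.const (-v0) z)).const_mul ht0.le)
  have hK : IsCompact (closedBall z1 (8 * ρ) \ O) := (isCompact_closedBall _ _).diff hO
  have hψO : ∀ y ∈ O, g y + t * (v y + -v0) ≤ 0 := by
    intro y hy
    have h1 := hOΩ y hy
    have h2 : t * (v y + -v0) ≤ t * (Real.log (2 / d) + 2 - v0) := by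
      gcongr; linarith [hv1 y]
    linarith
  have hmp := max_principle hK (ψ := fun z => g z + t * (v z + -v0))
    (fun z hz => (hgood z hz.2).usc.upperSemicontinuousWithinAt _) (by
      intro z hz
      by_cases hzs : z ∈ sphere z1 (8 * ρ)
      · left
        have h1 : 7 * ρ ≤ dist z a := by
          have := dist_triangle z a z1
          rw [mem_sphere.1 hzs] at this
          linarith
        have h2 := hv3 z (by linarith)
        have h3 : Real.log (6 * ρ) ≤ Real.log (dist z a - d) :=
          Real.log_le_log (by positivity) (by linarith)
        have h4 : t * (v z + -v0) ≤ 0 :=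
          mul_nonpos_of_nonneg_of_nonpos ht0.le (by rw [hv0]; linarith)
        linarith [hneg z hz.1]
      · right
        have hzb : z ∈ ball z1 (8 * ρ) := by
          rw [← closedBall_sdiff_sphere]; exact ⟨hz.1, hzs⟩
        have hev : ∀ᶠ y in 𝓝 z, y ∈ ball z1 (8 * ρ) := isOpen_ball.mem_nhds hzb
        filter_upwards [goodAt_avg (hgood z hz.2), eventually_line hev (1:ℂ)] with s hs hs0
        refine ⟨hs.1, hs.2, fun y hy => ?_⟩
        by_cases hyO' : y ∈ O
        · exact Or.inr (hψO y hyO')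
        · left
          refine ⟨ball_subset_closedBall ?_, hyO'⟩
          have := hs0.2 (y - z) (by
            rw [mem_closedBall_zero_iff]
            rw [mem_sphere_iff_norm] at hy
            exact hy.le)
          simpa using this)
  have h1 := hmp z1 ⟨mem_closedBall_self (by positivity), hz1O⟩
  have h2 := hv4 z1 (fun h => hz1O (hPO h))
  have h3 : Real.log (dist z1 a + d) ≤ Real.log (2 * ρ) := by
    apply Real.log_le_log (by positivity)
    rw [dist_comm]; linarith
  have h4 : Real.log (6 * ρ) = Real.log 3 + Real.log (2 * ρ) := by
    rw [← Real.log_mul (by norm_num) (by positivity)]; congr 1; ring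
  have h5 : t * Real.log 3 ≤ t * (v z1 + -v0) := by
    gcongr
    rw [hv0]; linarith
  have h6 : t * Real.log 3 ≤ m := by
    linarith
  have h7 : N * Real.log 3 ≤ m * (Real.log (2 / d) + 2 - v0) := by
    calc N * Real.log 3 = (t * Real.log 3) * (Real.log (2 / d) + 2 - v0) := by
          rw [← htL]; ring
      _ ≤ _ := by gcongr
  rw [hv0] at h7
  linarith

lemma polar_lemma {A : Set ℂ} (hA : PolarSet A) {K1 K2 : Set ℂ} (hK1 : IsCompact K1) (hK1A : K1 ⊆ A)
    (hK2 : IsCompact K2) (hdisj : Disjoint K1 K2) (R0 : ℝ) {ε : ℝ} (hε : 0 < ε) :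
    ∃ q : ℂ → ℝ, (∀ z, GoodAt q z) ∧ (∀ z, ‖z‖ ≤ R0 → q z ≤ 0) ∧ (∀ z ∈ K2, -ε ≤ q z) ∧
      (∀ z ∈ K1, q z ≤ -4) := by
  obtain ⟨u, hu, huA⟩ := hA
  obtain ⟨z1, -, hz1⟩ := hu.2.2.1 0 trivial
  have hut : ∀ z, u z ≠ ⊤ := fun z => hu.1 z trivial
  -- radius
  obtain ⟨ρ, hρ0, hρ⟩ : ∃ ρ > 0, K1 ∪ K2 ∪ closedBall 0 R0 ⊆ closedBall z1 ρ := by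
    have hb : Bornology.IsBounded (K1 ∪ K2 ∪ closedBall 0 R0) :=
      (hK1.isBounded.union hK2.isBounded).union isBounded_closedBall
    obtain ⟨ρ, hρ⟩ := hb.subset_closedBall z1
    exact ⟨max ρ 1, by positivity, hρ.trans (closedBall_subset_closedBall (le_max_left _ _))⟩
  -- upper bound
  obtain ⟨C, hC⟩ : ∃ C : ℝ, ∀ z ∈ closedBall z1 (8 * ρ), (max (u z) ((-0 : ℝ) : EReal)).toReal ≤ C := by
    obtain ⟨C, hC⟩ := UpperSemicontinuousOn.bddAbove_of_isCompact (isCompact_closedBall z1 (8 * ρ))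
      (f := fun z => (max (u z) ((-0 : ℝ) : EReal)).toReal)
      (fun z _ => (trunc_good hu 0 z).usc.upperSemicontinuousWithinAt _)
    exact ⟨C, fun z hz => hC ⟨z, hz, rfl⟩⟩
  -- distance
  obtain ⟨δ, hδ, hδd⟩ := hdisj.exists_thickenings hK1 hK2.isClosed
  set d := min δ ρ with hd
  have hd0 : 0 < d := lt_min hδ hρ0
  set m := |(u z1).toReal - C| + 1 with hm
  have hm0 : 0 < m := by positivity
  have hlog3 : 0 < Real.log 3 := Real.log_pos (by norm_num)
  obtain ⟨N, hN1, hN2⟩ : ∃ N : ℝ, m < N ∧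
      m * (Real.log (2 / d) + 2 + Real.log (6 * ρ)) < N * Real.log 3 := by
    refine ⟨max m (m * (Real.log (2 / d) + 2 + Real.log (6 * ρ)) / Real.log 3) + 1,
      by linarith [le_max_left m (m * (Real.log (2 / d) + 2 + Real.log (6 * ρ)) / Real.log 3)], ?_⟩
    rw [← div_lt_iff₀ hlog3]
    linarith [le_max_right m (m * (Real.log (2 / d) + 2 + Real.log (6 * ρ)) / Real.log 3)]
  have hN0 : 0 < N := hm0.trans hN1
  obtain ⟨T, hT0, hT1, hT2⟩ : ∃ T : ℝ, 0 ≤ T ∧ N < T + C ∧ 4 ≤ ε / N * (T + C) := by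
    refine ⟨|C| + N + 4 * N / ε + 1, by positivity, ?_, ?_⟩
    · have := neg_abs_le C
      have : 0 < 4 * N / ε := by positivity
      linarith
    · have h1 := neg_abs_le C
      calc (4:ℝ) = ε / N * (4 * N / ε) := by field_simp
        _ ≤ _ := by gcongr; linarith
  set g : ℂ → ℝ := fun z => (max (u z) ((-T : ℝ) : EReal)).toReal + -C with hg
  have hgg : ∀ z, GoodAt g z := fun z => (trunc_good hu T z).add (GoodAt.const _ z)
  have hneg : ∀ z ∈ closedBall z1 (8 * ρ), g z ≤ 0 := by
    intro z hz
    have h1 := hC z hz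
    have h2 : (max (u z) ((-T : ℝ) : EReal)).toReal ≤ (max (u z) ((-0 : ℝ) : EReal)).toReal := by
      rw [← EReal.coe_le_coe_iff, trunc_coe hut, trunc_coe hut]
      apply max_le_max le_rfl
      rw [EReal.coe_le_coe_iff]; linarith
    simp only [hg]; linarith
  have hgz1 : -m ≤ g z1 := by
    have h1 : (u z1).toReal ≤ (max (u z1) ((-T : ℝ) : EReal)).toReal := by
      rw [← EReal.coe_le_coe_iff, trunc_coe hut, EReal.coe_toReal (hut _) hz1]
      exact le_max_left _ _
    have h2 := neg_abs_le ((u z1).toReal - C)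
    simp only [hg, hm]; linarith
  have hgA : ∀ a ∈ K1, g a = -(T + C) := by
    intro a ha
    simp only [hg]
    rw [huA a (hK1A ha), max_eq_right bot_le, EReal.toReal_coe]; ring
  set Ω := {z | g z < -N} with hΩd
  have hΩ : IsOpen Ω := by
    rw [isOpen_iff_eventually]
    intro z hz
    exact upperSemicontinuousAt_iff.1 (hgg z).usc _ hz
  have hK1Ω : K1 ⊆ Ω := fun a ha => by
    simp only [hΩd, mem_ofPred_eq, hgA a ha]; linarith
  set W := ⋃ a ∈ K1, connectedComponentIn Ω a with hW
  have hWo : IsOpen W := isOpen_biUnion fun a _ => hΩ.connectedComponentIn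
  have hWK2 : ∀ z ∈ K2, z ∉ W := by
    intro z hz hzW
    obtain ⟨a, ha, hza⟩ := mem_iUnion₂.1 hzW
    have h1 := component_small hgg hρ0 hneg hgz1 hm0 (hρ (Or.inl (Or.inl ha))) hd0 (min_le_right _ _)
      hN1 hN2 (hK1Ω ha) hza
    have h2 : z ∈ thickening δ K1 := by
      rw [mem_thickening_iff]
      exact ⟨a, ha, (mem_ball.1 h1).trans_le (min_le_left _ _)⟩
    exact hδd.le_bot ⟨h2, self_subset_thickening hδ _ hz⟩
  have hWΩ : ∀ z ∈ Ω, z ∉ W → ∀ᶠ y in 𝓝 z, y ∈ Ω ∧ y ∉ W := by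
    intro z hz hzW
    have h1 : connectedComponentIn Ω z ∈ 𝓝 z :=
      hΩ.connectedComponentIn.mem_nhds (mem_connectedComponentIn hz)
    filter_upwards [h1] with y hy
    refine ⟨connectedComponentIn_subset _ _ hy, fun hyW => hzW ?_⟩
    obtain ⟨a, ha, hya⟩ := mem_iUnion₂.1 hyW
    refine mem_iUnion₂.2 ⟨a, ha, ?_⟩
    rw [connectedComponentIn_eq hya, ← connectedComponentIn_eq hy]
    exact mem_connectedComponentIn hz
  classical
  set q0 : ℂ → ℝ := fun z => if z ∈ W then g z else max (g z) (-N) with hq0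
  have hq0le : ∀ z, q0 z ≤ max (g z) (-N) := by
    intro z; simp only [hq0]; split_ifs
    · exact le_max_left _ _
    · exact le_rfl
  have hq0ge : ∀ z, g z ≤ q0 z := by
    intro z; simp only [hq0]; split_ifs
    · exact le_rfl
    · exact le_max_left _ _
  have hcase1 : ∀ z ∈ W, GoodAt q0 z := by
    intro z hz
    refine (hgg z).congr ?_
    filter_upwards [hWo.mem_nhds hz] with y hy
    simp only [hq0, if_pos hy]
  have hcase2 : ∀ z, z ∉ W → g z < -N → GoodAt q0 z := by
    intro z hz hgz
    refine (GoodAt.const (-N) z).congr ?_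
    filter_upwards [hWΩ z hgz hz] with y hy
    simp only [hq0, if_neg hy.2]
    rw [max_eq_right (le_of_lt hy.1)]
  have husc : ∀ z, UpperSemicontinuousAt q0 z := by
    intro z
    by_cases hz : z ∈ W
    · exact (hcase1 z hz).usc
    by_cases hgz : g z < -N
    · exact (hcase2 z hz hgz).usc
    · have h1 := ((hgg z).max (GoodAt.const (-N) z)).usc
      rw [upperSemicontinuousAt_iff] at *
      intro y hy
      have h2 : q0 z = max (g z) (-N) := by simp only [hq0, if_neg hz]
      rw [h2] at hy
      filter_upwards [h1 y hy] with x hx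
      exact (hq0le x).trans_lt hx
  have hgood : ∀ z, GoodAt q0 z := by
    intro z
    by_cases hz : z ∈ W
    · exact hcase1 z hz
    by_cases hgz : g z < -N
    · exact hcase2 z hz hgz
    · obtain ⟨mm, hmm⟩ := (hgg z).bdd
      refine goodAt_of_le (Eventually.of_forall husc) ⟨mm, hmm.mono fun y hy => hy.trans (hq0ge y)⟩
        (hgg z) (Eventually.of_forall hq0ge) ?_
      simp only [hq0, if_neg hz]
      exact max_eq_left (not_lt.1 hgz)
  have hc0 : 0 < ε / N := by positivity
  refine ⟨fun z => ε / N * q0 z, fun z => (hgood z).const_mul hc0.le, ?_, ?_, ?_⟩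
  · intro z hz
    have h1 : z ∈ closedBall z1 (8 * ρ) := by
      apply closedBall_subset_closedBall (by linarith : ρ ≤ 8 * ρ)
      exact hρ (Or.inr (by simpa using hz))
    apply mul_nonpos_of_nonneg_of_nonpos hc0.le
    exact (hq0le z).trans (max_le (hneg z h1) (by linarith))
  · intro z hz
    have h1 : -N ≤ q0 z := by
      simp only [hq0, if_neg (hWK2 z hz)]; exact le_max_right _ _
    calc -ε = ε / N * (-N) := by field_simp
      _ ≤ _ := mul_le_mul_of_nonneg_left h1 hc0.le
  · intro z hz
    have hzW : z ∈ W := mem_iUnion₂.2 ⟨z, hz, mem_connectedComponentIn (hK1Ω hz)⟩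
    simp only [hq0, if_pos hzW, hgA z hz]
    linarith

lemma isolated_ball {D A : Set ℂ} (hD : IsOpen D) (hAD : A ⊆ D) {a : ℂ} (ha : a ∈ A)
    (hai : a ∉ closure (A \ {a})) : ∃ r > 0, ball a r ⊆ D ∧ ∀ z ∈ ball a r, z ∈ A → z = a := by
  have h1 : D ∩ (closure (A \ {a}))ᶜ ∈ 𝓝 a :=
    (hD.inter isClosed_closure.isOpen_compl).mem_nhds ⟨hAD ha, hai⟩
  obtain ⟨r, hr, hb⟩ := Metric.mem_nhds_iff.1 h1
  refine ⟨r, hr, fun z hz => (hb hz).1, fun z hz hzA => ?_⟩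
  by_contra hne
  exact (hb hz).2 (subset_closure ⟨hzA, hne⟩)

lemma circle_hit {D A : Set ℂ} {f : ℂ → ℂ} (hD : IsOpen D) (hAD : A ⊆ D)
    (hf : DifferentiableOn ℂ f (D \ A))
    (hnoext : ∀ a ∈ A, ¬ ∃ (V : Set ℂ) (g : ℂ → ℂ), IsOpen V ∧ a ∈ V ∧ V ⊆ D ∧
      DifferentiableOn ℂ g V ∧ Set.EqOn f g (V \ A)) {a : ℂ} (ha : a ∈ A)
    (hai : a ∉ closure (A \ {a})) (M : ℝ) :
    ∃ r0 > 0, ∀ s ∈ Ioo 0 r0, ∃ z, dist z a = s ∧ M < ‖f z‖ := by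
  obtain ⟨r1, hr1, hbD, hbA⟩ := isolated_ball hD hAD ha hai
  by_contra! hcon
  obtain ⟨s0, hs0, hM0⟩ := hcon r1 hr1
  have hdiff : DifferentiableOn ℂ f (ball a r1 \ {a}) := by
    apply hf.mono
    rintro z ⟨hz, hza⟩
    exact ⟨hbD hz, fun h => hza (hbA z hz h)⟩
  have hbound : ∀ z ∈ ball a s0 \ {a}, ‖f z‖ ≤ M := by
    rintro z ⟨hz, hza⟩
    have hza' : 0 < dist z a := dist_pos.2 hza
    obtain ⟨s', hs', hM'⟩ := hcon (dist z a) hza'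
    set U := ball a s0 ∩ (closedBall a s')ᶜ with hU
    have hUo : IsOpen U := isOpen_ball.inter isClosed_closedBall.isOpen_compl
    have hcl : ∀ y ∈ closure U, s' ≤ dist y a ∧ dist y a ≤ s0 := by
      have : closure U ⊆ {y | s' ≤ dist y a ∧ dist y a ≤ s0} := by
        apply closure_minimal
        · rintro y ⟨h1, h2⟩
          rw [mem_ball] at h1
          rw [mem_compl_iff, mem_closedBall, not_le] at h2
          exact ⟨h2.le, h1.le⟩
        · have e1 : IsClosed {y : ℂ | s' ≤ dist y a} := isClosed_le (by fun_prop) (by fun_prop)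
          have e2 : IsClosed {y : ℂ | dist y a ≤ s0} := isClosed_le (by fun_prop) (by fun_prop)
          exact e1.inter e2
      exact fun y hy => this hy
    have hd : DiffContOnCl ℂ f U := by
      apply DifferentiableOn.diffContOnCl
      apply hdiff.mono
      intro y hy
      have := hcl y hy
      refine ⟨by rw [mem_ball]; linarith [hs0.2], ?_⟩
      intro h
      rw [mem_singleton_iff] at h
      rw [h, dist_self] at this
      linarith [hs'.1]
    refine Complex.norm_le_of_forall_mem_frontier_norm_le (U := U)
      (isBounded_ball.subset inter_subset_left) hd ?_ (subset_closure ⟨hz, ?_⟩)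
    · intro y hy
      rw [hUo.frontier_eq] at hy
      have h1 := hcl y hy.1
      rcases h1.1.eq_or_lt with h2 | h2
      · exact hM' y h2.symm
      · rcases h1.2.eq_or_lt with h3 | h3
        · exact hM0 y h3
        · exact absurd ⟨mem_ball.2 h3, by simpa using h2⟩ hy.2
    · simpa using hs'.2
  have hsub : ball a s0 ⊆ ball a r1 := ball_subset_ball hs0.2.le
  have := Complex.differentiableOn_update_limUnder_of_bddAbove (f := f) (c := a)
    (ball_mem_nhds a hs0.1) (hdiff.mono (sdiff_subset_sdiff_left hsub)) (by
      refine ⟨M, ?_⟩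
      rintro _ ⟨z, hz, rfl⟩
      exact hbound z hz)
  refine hnoext a ha ⟨ball a s0, _, isOpen_ball, mem_ball_self hs0.1, hsub.trans hbD, this, ?_⟩
  rintro z ⟨hz, hzA⟩
  have : z ≠ a := fun h => hzA (h ▸ ha)
  simp [Function.update_of_ne this]

/-- reciprocal distance to the complement -/
noncomputable def ee (U : Set ℂ) (z : ℂ) : ℝ := (infDist z Uᶜ)⁻¹

/-- exhaustion by compact sets -/
def exh (U : Set ℂ) (n : ℝ) : Set ℂ := {z | z ∈ U ∧ ‖z‖ ≤ n ∧ ee U z ≤ n}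

/-- exhaustion function of `D × ℂ` -/
noncomputable def tau (D : Set ℂ) (p : ℂ × ℂ) : ℝ := max (max ‖p.1‖ ‖p.2‖) (ee D p.1)

lemma infDist_pos_of_mem {U : Set ℂ} (hU : IsOpen U) (hne : Uᶜ.Nonempty) {z : ℂ} (hz : z ∈ U) :
    0 < infDist z Uᶜ :=
  (hU.isClosed_compl.notMem_iff_infDist_pos hne).1 (fun h => h hz)

lemma isCompact_exh {U : Set ℂ} (hU : IsOpen U) {n : ℝ} (hn : 0 < n) : IsCompact (exh U n) := by
  rcases Uᶜ.eq_empty_or_nonempty with h | h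
  · have : exh U n = closedBall 0 n := by
      ext z
      simp only [exh, ee, h, infDist_empty, inv_zero, mem_ofPred_eq, mem_closedBall_zero_iff]
      have : z ∈ U := by
        by_contra hc
        have : z ∈ Uᶜ := hc
        rw [h] at this; exact this
      simp [this, hn.le]
    rw [this]; exact isCompact_closedBall _ _
  · have : exh U n = closedBall 0 n ∩ {z | n⁻¹ ≤ infDist z Uᶜ} := by
      ext z
      simp only [exh, ee, mem_ofPred_eq, mem_inter_iff, mem_closedBall_zero_iff]
      constructor
      · rintro ⟨h1, h2, h3⟩
        exact ⟨h2, inv_le_of_inv_le₀ (infDist_pos_of_mem hU h h1) h3⟩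
      · rintro ⟨h1, h2⟩
        have h3 : 0 < n⁻¹ := by positivity
        refine ⟨?_, h1, inv_le_of_inv_le₀ hn h2⟩
        by_contra hc
        have : infDist z Uᶜ = 0 := infDist_zero_of_mem hc
        linarith
    rw [this]
    apply (isCompact_closedBall _ _).inter_right
    exact isClosed_le continuous_const (continuous_infDist_pt _)

lemma continuousAt_ee {U : Set ℂ} (hU : IsOpen U) {z : ℂ} (hz : z ∈ U) : ContinuousAt (ee U) z := by
  rcases Uᶜ.eq_empty_or_nonempty with h | h
  · have : ee U = fun _ => 0 := by funext z; simp [ee, h]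
    rw [this]; exact continuousAt_const
  · exact (continuous_infDist_pt _).continuousAt.inv₀ (infDist_pos_of_mem hU h hz).ne'

lemma goodAt_ee {U : Set ℂ} (hU : IsOpen U) {z : ℂ} (hz : z ∈ U) : GoodAt (ee U) z := by
  rcases Uᶜ.eq_empty_or_nonempty with h | h
  · have : ee U = fun _ => 0 := by funext z; simp [ee, h]
    rw [this]; exact GoodAt.const 0 z
  · obtain ⟨ζ, hζ, hd⟩ := hU.isClosed_compl.exists_infDist_eq_dist h z
    have hzζ : z ≠ ζ := fun h' => hζ (h' ▸ hz)
    have hgood : GoodAt (fun y => ‖(y - ζ)⁻¹‖) z := by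
      apply goodAt_norm
      filter_upwards [isOpen_ne.mem_nhds hzζ] with y hy
      exact (differentiableAt_id.sub_const ζ).inv (sub_ne_zero.2 hy)
    refine goodAt_of_le ?_ (bdd_of_continuousAt (continuousAt_ee hU hz)) hgood ?_ ?_
    · filter_upwards [hU.mem_nhds hz] with y hy
      exact (continuousAt_ee hU hy).upperSemicontinuousAt
    · filter_upwards [hU.mem_nhds hz] with y hy
      rw [norm_inv, ← dist_eq_norm]
      exact inv_anti₀ (infDist_pos_of_mem hU h hy) (infDist_le_dist_of_mem hζ)
    · rw [norm_inv, ← dist_eq_norm, ee, hd]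

lemma goodAt_tau {D : Set ℂ} (hD : IsOpen D) {p : ℂ × ℂ} (hp : p.1 ∈ D) : GoodAt (tau D) p := by
  refine ((goodAt_norm (h := fun p : ℂ × ℂ => p.1) ?_).max
    (goodAt_norm (h := fun p : ℂ × ℂ => p.2) ?_)).max (GoodAt.comp_fst (goodAt_ee hD hp))
  · exact Eventually.of_forall fun y => differentiableAt_fst
  · exact Eventually.of_forall fun y => differentiableAt_snd

lemma continuousAt_tau {D : Set ℂ} (hD : IsOpen D) {p : ℂ × ℂ} (hp : p.1 ∈ D) :
    ContinuousAt (tau D) p := by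
  have h1 : ContinuousAt (fun p : ℂ × ℂ => ee D p.1) p :=
    ContinuousAt.comp (f := Prod.fst) (continuousAt_ee hD hp) continuousAt_fst
  have h2 : ContinuousAt (fun p : ℂ × ℂ => max ‖p.1‖ ‖p.2‖) p := by fun_prop
  exact h2.max h1

/-- main construction from theta data -/
lemma main1 {D A B : Set ℂ} {f : ℂ → ℂ} (hD : IsOpen D) (hAclosed : ∀ z ∈ D, z ∈ closure A → z ∈ A)
    (hApolar : PolarSet A) (hf : DifferentiableOn ℂ f (D \ A)) (hBA : B ⊆ A) (hAD : A ⊆ D)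
    {n ε : ℝ} (hn : 1 ≤ n) (hε : 0 < ε) (hε4 : ε ≤ 1 / 4) {P : Set ℂ} {θ : ℂ → ℝ}
    (hP : IsCompact P) (hPDA : P ⊆ D \ A) (hPf : ∀ z ∈ P, 2 * (n + 3) < ‖f z‖)
    (hθ0 : ∀ z, θ z ≤ 0) (hθ1 : ∀ z, -1 ≤ θ z) (hθg : ∀ z, z ∉ P → GoodAt θ z)
    (hθe : ∀ z ∈ exh (D \ A) n, θ z ≤ -1) (hθB : ∀ z ∈ B, θ z ≤ -1) :
    ∃ Φ : ℂ × ℂ → ℝ, (∀ p : ℂ × ℂ, p.1 ∈ D → GoodAt Φ p) ∧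
      (∀ p : ℂ × ℂ, p.1 ∈ D → tau D p ≤ n → Φ p ≤ 0) ∧
      (∀ z w, z ∈ exh (D \ A) n → tau D (z, w) ≤ n → w = f z → Φ (z, w) ≤ -1) ∧
      (∀ z w, z ∈ B → tau D (z, w) ≤ n → Φ (z, w) ≤ -1) ∧
      (∀ z w, z ∈ exh (D \ A) n → tau D (z, w) ≤ n → n⁻¹ ≤ ‖w - f z‖ → -4 * ε ≤ Φ (z, w)) ∧
      (∀ z w, tau D (z, w) ≤ n → θ z - 3 * ε ≤ Φ (z, w)) := by
  set R := n + 3 with hR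
  have hDA : IsOpen (D \ A) := by
    have : D \ A = D ∩ (closure A)ᶜ := by
      ext z
      constructor
      · rintro ⟨h1, h2⟩; exact ⟨h1, fun h => h2 (hAclosed z h1 h)⟩
      · rintro ⟨h1, h2⟩; exact ⟨h1, fun h => h2 (subset_closure h)⟩
    rw [this]; exact hD.inter isClosed_closure.isOpen_compl
  have hX : IsCompact (exh D R) := isCompact_exh hD (by linarith)
  have hAX : IsCompact (exh D R \ (D \ A)) := hX.diff hDA
  have hAXA : exh D R \ (D \ A) ⊆ A := by
    rintro z ⟨hz, hzA⟩
    by_contra hc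
    exact hzA ⟨hz.1, hc⟩
  -- compact neighbourhood of P
  obtain ⟨η, hη, hηP⟩ := hP.exists_cthickening_subset_open hDA hPDA
  have hK2 : IsCompact (exh (D \ A) n ∪ cthickening η P) :=
    (isCompact_exh hDA (by linarith)).union hP.cthickening
  have hdisj : Disjoint (exh D R \ (D \ A)) (exh (D \ A) n ∪ cthickening η P) := by
    rw [Set.disjoint_left]
    rintro z hz (h | h)
    · exact hz.2 h.1
    · exact hz.2 (hηP h)
  obtain ⟨q, hqg, hq0, hqK2, hqA⟩ := polar_lemma hApolar hAX hAXA hK2 hdisj R hε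
  have hq3 : IsOpen {z | q z < -3} := by
    rw [isOpen_iff_eventually]
    intro z hz
    exact upperSemicontinuousAt_iff.1 (hqg z).usc _ hz
  obtain ⟨η1, hη1, hη1q⟩ := hAX.exists_cthickening_subset_open hq3
    (fun z hz => by have := hqA z hz; simp only [mem_ofPred_eq]; linarith)
  set W1 := thickening η1 (exh D R \ (D \ A)) with hW1
  have hW1q : ∀ z ∈ W1, q z < -3 := fun z hz => by
    have : z ∈ {z | q z < -3} := hη1q (thickening_subset_cthickening _ _ hz)
    exact this
  classical
  set f' : ℂ → ℂ := fun z => if z ∈ W1 then 0 else f z with hf'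
  have hXW : IsCompact (exh D R \ W1) := hX.diff isOpen_thickening
  have hXWsub : exh D R \ W1 ⊆ D \ A := by
    rintro z ⟨hz, hzW⟩
    by_contra hc
    exact hzW (self_subset_thickening hη1 _ ⟨hz, hc⟩)
  obtain ⟨M0, hM0⟩ := hXW.exists_bound_of_continuousOn (hf.continuousOn.mono hXWsub)
  have hf'b : ∀ z ∈ exh D R, ‖f' z‖ ≤ max M0 0 := by
    intro z hz
    simp only [hf']
    split_ifs with h
    · simp
    · exact (hM0 z ⟨hz, h⟩).trans (le_max_left _ _)
  set c := Real.log (R + max M0 0) with hc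
  have hRM : 1 ≤ R + max M0 0 := by
    have := le_max_right M0 0
    linarith
  have hc0 : 0 ≤ c := Real.log_nonneg hRM
  have hlogn : 0 ≤ Real.log n := Real.log_nonneg hn
  set δ := ε / (Real.log n + c + 1) with hδ
  have hδ0 : 0 < δ := by positivity
  have hδe : δ * (Real.log n + c + 1) = ε := by rw [hδ]; field_simp
  have hδn : δ * (Real.log n + c) ≤ ε := by nlinarith
  have hδc : δ * c ≤ ε := by nlinarith
  set κ := Real.exp (c - 1 / δ) with hκ
  have hκ0 : 0 < κ := Real.exp_pos _
  have hκc : κ ≤ R + max M0 0 := by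
    have : R + max M0 0 = Real.exp c := by rw [hc, Real.exp_log (by linarith)]
    rw [this]
    apply Real.exp_le_exp.2
    have : 0 < 1 / δ := by positivity
    linarith
  set Ψ : ℂ × ℂ → ℝ := fun p => δ * (Real.log (max ‖p.2 - f' p.1‖ κ) + -c) + q p.1 with hΨ
  set Φi : ℂ × ℂ → ℝ := fun p => max (Ψ p) (θ p.1 + -(3 * ε)) with hΦi
  -- facts in tau < R
  have htauX : ∀ p : ℂ × ℂ, p.1 ∈ D → tau D p ≤ R → p.1 ∈ exh D R ∧ ‖p.2‖ ≤ R := by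
    intro p hp ht
    simp only [tau, max_le_iff] at ht
    exact ⟨⟨hp, ht.1.1, ht.2⟩, ht.1.2⟩
  have hΨq : ∀ p : ℂ × ℂ, p.1 ∈ D → tau D p ≤ R → Ψ p ≤ q p.1 := by
    intro p hp ht
    obtain ⟨h1, h2⟩ := htauX p hp ht
    have h3 : max ‖p.2 - f' p.1‖ κ ≤ R + max M0 0 := by
      refine max_le ?_ hκc
      have := norm_sub_le p.2 (f' p.1)
      linarith [hf'b p.1 h1]
    have h4 : Real.log (max ‖p.2 - f' p.1‖ κ) ≤ c :=
      Real.log_le_log (lt_max_of_lt_right hκ0) h3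
    have : δ * (Real.log (max ‖p.2 - f' p.1‖ κ) + -c) ≤ 0 :=
      mul_nonpos_of_nonneg_of_nonpos hδ0.le (by linarith)
    simp only [hΨ]; linarith
  have hΦi0 : ∀ p : ℂ × ℂ, p.1 ∈ D → tau D p ≤ R → Φi p ≤ 0 := by
    intro p hp ht
    refine max_le ((hΨq p hp ht).trans (hq0 _ (htauX p hp ht).1.2.1)) ?_
    linarith [hθ0 p.1]
  -- goodness of Φi
  have hΨg : ∀ p : ℂ × ℂ, p.1 ∈ D → tau D p < R → -3 ≤ q p.1 → GoodAt Ψ p := by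
    intro p hp ht hq
    have hpA : p.1 ∈ D \ A := by
      by_contra hcon
      have := hqA p.1 ⟨(htauX p hp ht.le).1, hcon⟩
      linarith
    have hW1n : ∀ᶠ z in 𝓝 p.1, z ∉ W1 := by
      have h1 : p.1 ∉ cthickening η1 (exh D R \ (D \ A)) := fun h => by
        have : p.1 ∈ {z | q z < -3} := hη1q h
        simp only [mem_ofPred_eq] at this
        linarith
      filter_upwards [isClosed_cthickening.isOpen_compl.mem_nhds h1] with z hz hzW
      exact hz (thickening_subset_cthickening _ _ hzW)
    have hlog : GoodAt (fun p : ℂ × ℂ => Real.log (max ‖p.2 - f p.1‖ κ)) p := by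
      apply goodAt_log_max (h := fun p : ℂ × ℂ => p.2 - f p.1) _ hκ0
      filter_upwards [continuousAt_fst.eventually (hDA.mem_nhds hpA)] with y hy
      apply differentiableAt_snd.sub
      exact ((hf.differentiableAt (hDA.mem_nhds hy)).comp y differentiableAt_fst)
    refine (((hlog.add (GoodAt.const (-c) p)).const_mul hδ0.le).add
      (GoodAt.comp_fst (hqg p.1))).congr ?_
    filter_upwards [continuousAt_fst.eventually hW1n] with y hy
    simp only [hΨ, hf', if_neg hy]
  have htauev : ∀ p : ℂ × ℂ, p.1 ∈ D → ∀ b, tau D p < b → ∀ᶠ y in 𝓝 p, y.1 ∈ D ∧ tau D y < b := by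
    intro p hp b hb
    exact (continuousAt_fst.eventually (hD.mem_nhds hp)).and
      ((continuousAt_tau hD hp).eventually (gt_mem_nhds hb))
  have hΦig : ∀ p : ℂ × ℂ, p.1 ∈ D → tau D p < R → GoodAt Φi p := by
    intro p hp ht
    by_cases hpP : p.1 ∈ P
    · have hq1 : -ε ≤ q p.1 := hqK2 _ (Or.inr (self_subset_cthickening _ hpP))
      refine (hΨg p hp ht (by linarith)).congr ?_
      have e1 : ∀ᶠ z in 𝓝 p.1, z ∈ cthickening η P := by
        filter_upwards [isOpen_thickening.mem_nhds (self_subset_thickening hη P hpP)] with z hz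
        exact thickening_subset_cthickening _ _ hz
      have e2 : ∀ᶠ z in 𝓝 p.1, 2 * R < ‖f z‖ := by
        have := (hf.differentiableAt (hDA.mem_nhds (hPDA hpP))).continuousAt.norm
        exact this.eventually (lt_mem_nhds (hPf _ hpP))
      filter_upwards [htauev p hp R ht, continuousAt_fst.eventually e1,
        continuousAt_fst.eventually e2] with y hy1 hy2 hy3
      simp only [hΦi]
      symm
      apply max_eq_left
      have hqy : -ε ≤ q y.1 := hqK2 _ (Or.inr hy2)
      have hyW : y.1 ∉ W1 := fun h => by linarith [hW1q _ h]
      have h2 := (htauX y hy1.1 hy1.2.le).2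
      have h3 : 1 ≤ max ‖y.2 - f' y.1‖ κ := by
        refine le_max_of_le_left ?_
        simp only [hf', if_neg hyW]
        have := norm_sub_norm_le (f y.1) y.2
        rw [norm_sub_rev] at this
        linarith
      have h4 : 0 ≤ Real.log (max ‖y.2 - f' y.1‖ κ) := Real.log_nonneg h3
      have h5 : δ * (-c) ≤ δ * (Real.log (max ‖y.2 - f' y.1‖ κ) + -c) := by
        gcongr; linarith
      simp only [hΨ]
      linarith [hθ0 y.1]
    · have hθp : GoodAt (fun p : ℂ × ℂ => θ p.1 + -(3 * ε)) p :=
        (GoodAt.comp_fst (hθg _ hpP)).add (GoodAt.const _ p)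
      by_cases hq : q p.1 < -3
      · refine hθp.congr ?_
        filter_upwards [htauev p hp R ht, continuousAt_fst.eventually (hq3.mem_nhds hq)] with y hy1 hy2
        simp only [hΦi]
        symm
        apply max_eq_right
        have h1 := hΨq y hy1.1 hy1.2.le
        have h2 : q y.1 < -3 := hy2
        linarith [hθ1 y.1]
      · exact (hΨg p hp ht (not_lt.1 hq)).max hθp
  have hTg : ∀ p : ℂ × ℂ, p.1 ∈ D → GoodAt (fun p => 3 * (tau D p + -(n + 1))) p := fun p hp =>
    ((goodAt_tau hD hp).add (GoodAt.const _ p)).const_mul (by norm_num)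
  refine ⟨fun p => if tau D p < n + 2 then max (Φi p) (3 * (tau D p + -(n + 1)))
    else 3 * (tau D p + -(n + 1)), ?_, ?_, ?_, ?_, ?_, ?_⟩
  · intro p hp
    by_cases ht : tau D p < n + 2
    · refine ((hΦig p hp (by linarith)).max (hTg p hp)).congr ?_
      filter_upwards [htauev p hp _ ht] with y hy
      rw [if_pos hy.2]
    · push Not at ht
      refine (hTg p hp).congr ?_
      have e1 : ∀ᶠ y in 𝓝 p, n + 1 < tau D y :=
        (continuousAt_tau hD hp).eventually (lt_mem_nhds (by linarith))
      filter_upwards [e1, continuousAt_fst.eventually (hD.mem_nhds hp)] with y hy hyD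
      split_ifs with h
      · symm
        apply max_eq_right
        have := hΦi0 y hyD (by linarith)
        linarith
      · rfl
  · intro p hp ht
    simp only
    rw [if_pos (by linarith)]
    exact max_le (hΦi0 p hp (by linarith)) (by linarith)
  · intro z w hz ht hw
    simp only
    rw [if_pos (by linarith)]
    have hqz : -ε ≤ q z := hqK2 z (Or.inl hz)
    have hzW : z ∉ W1 := fun h => by linarith [hW1q _ h]
    refine max_le (max_le ?_ ?_) (by linarith)
    · simp only [hΨ, hf', if_neg hzW, hw, sub_self, norm_zero]
      rw [max_eq_right hκ0.le, hκ, Real.log_exp]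
      have : δ * (c - 1 / δ + -c) = -1 := by field_simp; ring
      rw [this]
      have := hq0 z (by linarith [hz.2.1])
      linarith
    · simp only; linarith [hθe z hz]
  · intro z w hz ht
    simp only
    rw [if_pos (by linarith)]
    have hzD : z ∈ D := hAD (hBA hz)
    refine max_le (max_le ?_ ?_) (by linarith)
    · have h1 := hΨq (z, w) hzD (by linarith)
      have h2 := hqA z ⟨(htauX (z, w) hzD (by linarith)).1, fun h => h.2 (hBA hz)⟩
      simp only at h1
      linarith
    · simp only; linarith [hθB z hz]
  · intro z w hz ht hw
    simp only
    rw [if_pos (by linarith)]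
    refine le_max_of_le_left (le_max_of_le_left ?_)
    have hqz : -ε ≤ q z := hqK2 z (Or.inl hz)
    have hzW : z ∉ W1 := fun h => by linarith [hW1q _ h]
    simp only [hΨ, hf', if_neg hzW]
    have h1 : Real.log n⁻¹ ≤ Real.log (max ‖w - f z‖ κ) :=
      Real.log_le_log (by positivity) (le_max_of_le_left hw)
    rw [Real.log_inv] at h1
    have h2 : δ * (-(Real.log n + c)) ≤ δ * (Real.log (max ‖w - f z‖ κ) + -c) := by
      gcongr; linarith
    linarith
  · intro z w ht
    simp only
    rw [if_pos (by linarith)]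
    refine le_max_of_le_left (le_max_of_le_right ?_)
    simp only; linarith

lemma isOpen_diff_of {D A : Set ℂ} (hD : IsOpen D) (hAclosed : ∀ z ∈ D, z ∈ closure A → z ∈ A) :
    IsOpen (D \ A) := by
  have : D \ A = D ∩ (closure A)ᶜ := by
    ext z
    constructor
    · rintro ⟨h1, h2⟩; exact ⟨h1, fun h => h2 (hAclosed z h1 h)⟩
    · rintro ⟨h1, h2⟩; exact ⟨h1, fun h => h2 (subset_closure h)⟩
  rw [this]
  exact hD.inter isClosed_closure.isOpen_compl

lemma theta_data {D A B : Set ℂ} {f : ℂ → ℂ} (hD : IsOpen D)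
    (hAclosed : ∀ z ∈ D, z ∈ closure A → z ∈ A)
    (hf : DifferentiableOn ℂ f (D \ A)) (hBA : B ⊆ A) (hAD : A ⊆ D)
    (hnoext : ∀ a ∈ A, ¬ ∃ (V : Set ℂ) (g : ℂ → ℂ), IsOpen V ∧ a ∈ V ∧ V ⊆ D ∧
      DifferentiableOn ℂ g V ∧ Set.EqOn f g (V \ A)) {a : ℂ} (ha : a ∈ A)
    (hai : a ∉ closure (A \ {a})) (haB : a ∉ B)
    {n ε : ℝ} (hn : 1 ≤ n) (hε : 0 < ε) :
    ∃ (P : Set ℂ) (θ : ℂ → ℝ), IsCompact P ∧ P ⊆ D \ A ∧ (∀ z ∈ P, 2 * (n + 3) < ‖f z‖) ∧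
      (∀ z, θ z ≤ 0) ∧ (∀ z, -1 ≤ θ z) ∧ (∀ z, z ∉ P → GoodAt θ z) ∧
      (∀ z ∈ exh (D \ A) n, θ z ≤ -1) ∧ (∀ z ∈ B, θ z ≤ -1) ∧ -ε ≤ θ a := by
  have hDA := isOpen_diff_of hD hAclosed
  obtain ⟨r1, hr1, hbD, hbA⟩ := isolated_ball hD hAD ha hai
  obtain ⟨r0, hr0, hhit⟩ := circle_hit hD hAD hf hnoext ha hai (2 * (n + 3))
  have hK := isCompact_exh hDA (show 0 < n by linarith)
  have haK : a ∉ exh (D \ A) n := fun h => h.1.2 ha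
  obtain ⟨κ, hκ, hκb⟩ := Metric.mem_nhds_iff.1
    (inter_mem (hK.isClosed.isOpen_compl.mem_nhds haK) (ball_mem_nhds a hr1))
  have hl2 : 0 < Real.log 2 := Real.log_pos (by norm_num)
  set lam := (2 + Real.log 2) / ε with hlam
  have hlam0 : 0 < lam := by positivity
  set d := min (min (r0 / 2) (κ / 2)) (κ * Real.exp (-lam)) with hd
  have hd0 : 0 < d := by
    have := Real.exp_pos (-lam)
    simp only [hd, lt_min_iff]
    exact ⟨⟨by linarith, by linarith⟩, by positivity⟩
  have hd1 : d ≤ r0 / 2 := (min_le_left _ _).trans (min_le_left _ _)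
  have hd2 : d ≤ κ / 2 := (min_le_left _ _).trans (min_le_right _ _)
  have hd3 : Real.log d ≤ Real.log κ - lam := by
    have := Real.log_le_log hd0 (min_le_right _ _ : d ≤ κ * Real.exp (-lam))
    rw [Real.log_mul hκ.ne' (Real.exp_pos _).ne', Real.log_exp] at this
    linarith
  set O := (ball a κ \ {a}) ∩ (D \ A) ∩ f ⁻¹' {w | 2 * (n + 3) < ‖w‖} with hO
  have hOo : IsOpen O := by
    have h1 : IsOpen ((ball a κ \ {a}) ∩ (D \ A)) :=
      (isOpen_ball.sdiff isClosed_singleton).inter hDA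
    exact (hf.continuousOn.mono inter_subset_right).isOpen_inter_preimage h1
      (isOpen_lt continuous_const continuous_norm)
  have hball : ∀ z ∈ ball a κ, z ≠ a → z ∈ D \ A := fun z hz hne =>
    ⟨hbD (hκb hz).2, fun h => hne (hbA z (hκb hz).2 h)⟩
  obtain ⟨P, v, hP, hPO, hv1, hv2, hv3, hv4⟩ := V_lemma a hd0 hOo (by
    intro s hs
    obtain ⟨z, hz, hz2⟩ := hhit s ⟨by linarith [hs.1], by linarith [hs.2]⟩
    have hzb : z ∈ ball a κ := by rw [mem_ball, hz]; linarith [hs.2]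
    have hza : z ≠ a := by
      rintro rfl
      rw [dist_self] at hz; linarith [hs.1]
    exact ⟨z, ⟨⟨⟨hzb, hza⟩, hball z hzb hza⟩, hz2⟩, hz⟩)
  have hl : Real.log (2 / d) = Real.log 2 - Real.log d := Real.log_div (by norm_num) hd0.ne'
  rw [hl] at hv1
  have hfar : ∀ z, κ ≤ dist z a → lam⁻¹ * (v z + (-(Real.log 2 - Real.log d + 2))) ≤ -1 := by
    intro z hz
    have h1 := hv3 z (by linarith)
    have h2 := Real.log_le_log (by linarith : 0 < κ / 2) (by linarith : κ / 2 ≤ dist z a - d)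
    rw [Real.log_div hκ.ne' (by norm_num)] at h2
    rw [inv_mul_le_iff₀ hlam0]
    linarith
  refine ⟨P, fun z => max (lam⁻¹ * (v z + (-(Real.log 2 - Real.log d + 2)))) (-1), hP,
    fun z hz => (hPO hz).1.2, fun z hz => (hPO hz).2, fun z => ?_, fun z => le_max_right _ _,
    fun z hz => ?_, fun z hz => ?_, fun z hz => ?_, ?_⟩
  · refine max_le ?_ (by norm_num)
    apply mul_nonpos_of_nonneg_of_nonpos (by positivity)
    linarith [hv1 z]
  · exact (((hv2 z hz).add (GoodAt.const _ z)).const_mul (by positivity)).max (GoodAt.const _ z)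
  · refine max_le (hfar z ?_) le_rfl
    by_contra! h
    exact (hκb (mem_ball.2 h)).1 hz
  · refine max_le (hfar z ?_) le_rfl
    by_contra! h
    have := hbA z (hκb (mem_ball.2 h)).2 (hBA hz)
    exact haB (this ▸ hz)
  · refine le_max_of_le_left ?_
    have haP : a ∉ P := fun h => (hPO h).1.1.2 rfl
    have := hv4 a haP
    rw [dist_self, zero_add] at this
    have h2 : lam⁻¹ * (2 + Real.log 2) = ε := by rw [hlam]; field_simp
    have h3 : lam⁻¹ * (-(2 + Real.log 2)) ≤ lam⁻¹ * (v a + (-(Real.log 2 - Real.log d + 2))) :=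
      mul_le_mul_of_nonneg_left (by linarith) (by positivity)
    linarith

lemma main3 {D A B : Set ℂ} {f : ℂ → ℂ} (hD : IsOpen D)
    (hAclosed : ∀ z ∈ D, z ∈ closure A → z ∈ A) (hApolar : PolarSet A)
    (hf : DifferentiableOn ℂ f (D \ A)) (hBA : B ⊆ A) (hAD : A ⊆ D)
    (hnoext : ∀ a ∈ A, ¬ ∃ (V : Set ℂ) (g : ℂ → ℂ), IsOpen V ∧ a ∈ V ∧ V ⊆ D ∧
      DifferentiableOn ℂ g V ∧ Set.EqOn f g (V \ A))
    {n ε : ℝ} (hn : 1 ≤ n) (hε : 0 < ε) (hε4 : ε ≤ 1 / 4) (F : Finset ℂ)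
    (hF : ∀ a ∈ F, a ∈ A ∧ a ∉ closure (A \ {a}) ∧ a ∉ B) :
    ∃ Φ : ℂ × ℂ → ℝ, (∀ p : ℂ × ℂ, p.1 ∈ D → GoodAt Φ p) ∧
      (∀ p : ℂ × ℂ, p.1 ∈ D → tau D p ≤ n → Φ p ≤ 0) ∧
      (∀ z w, z ∈ exh (D \ A) n → tau D (z, w) ≤ n → w = f z → Φ (z, w) ≤ -1) ∧
      (∀ z w, z ∈ B → tau D (z, w) ≤ n → Φ (z, w) ≤ -1) ∧
      (∀ z w, z ∈ exh (D \ A) n → tau D (z, w) ≤ n → n⁻¹ ≤ ‖w - f z‖ → -4 * ε ≤ Φ (z, w)) ∧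
      (∀ a ∈ F, ∀ w, tau D (a, w) ≤ n → -4 * ε ≤ Φ (a, w)) := by
  classical
  induction F using Finset.induction_on with
  | empty =>
    obtain ⟨Φ, h1, h2, h3, h4, h5, -⟩ := main1 (P := ∅) (θ := fun _ => -1) hD hAclosed hApolar hf
      hBA hAD hn hε hε4 isCompact_empty (empty_subset _) (by simp) (by simp) (by simp)
      (fun z _ => GoodAt.const _ z) (by simp) (by simp)
    exact ⟨Φ, h1, h2, h3, h4, h5, by simp⟩
  | insert a F haF ih =>
    obtain ⟨Φ, h1, h2, h3, h4, h5, h6⟩ := ih (fun b hb => hF b (Finset.mem_insert_of_mem hb))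
    obtain ⟨ha1, ha2, ha3⟩ := hF a (Finset.mem_insert_self _ _)
    obtain ⟨P, θ, t1, t2, t3, t4, t5, t6, t7, t8, t9⟩ :=
      theta_data hD hAclosed hf hBA hAD hnoext ha1 ha2 ha3 hn hε
    obtain ⟨Ψ, g1, g2, g3, g4, g5, g6⟩ :=
      main1 hD hAclosed hApolar hf hBA hAD hn hε hε4 t1 t2 t3 t4 t5 t6 t7 t8
    refine ⟨fun p => max (Φ p) (Ψ p), fun p hp => (h1 p hp).max (g1 p hp),
      fun p hp ht => max_le (h2 p hp ht) (g2 p hp ht),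
      fun z w hz ht hw => max_le (h3 z w hz ht hw) (g3 z w hz ht hw),
      fun z w hz ht => max_le (h4 z w hz ht) (g4 z w hz ht),
      fun z w hz ht hw => le_max_of_le_left (h5 z w hz ht hw), ?_⟩
    intro b hb w ht
    rcases Finset.mem_insert.1 hb with rfl | hb
    · exact le_max_of_le_right (by linarith [g6 b w ht])
    · exact le_max_of_le_left (h6 b hb w ht)

/-- monotone convergence for antitone sequences with bounded integrals -/
lemma antitone_conv {α : Type*} [MeasurableSpace α] {μ : Measure α} {F : ℕ → α → ℝ} {U : α → EReal}
    (hF : ∀ N, Integrable (F N) μ) (hanti : ∀ᵐ x ∂μ, Antitone (fun N => F N x))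
    (hlim : ∀ᵐ x ∂μ, Tendsto (fun N => (F N x : EReal)) atTop (𝓝 (U x)))
    {C : ℝ} (hC : ∀ N, C ≤ ∫ x, F N x ∂μ) :
    (∀ᵐ x ∂μ, U x ≠ ⊥) ∧ Integrable (fun x => (U x).toReal) μ ∧ C ≤ ∫ x, (U x).toReal ∂μ := by
  set G : ℕ → α → ENNReal := fun N x => ENNReal.ofReal (F 0 x - F N x) with hG
  have hGm : ∀ N, AEMeasurable (G N) μ := fun N =>
    ((hF 0).sub (hF N)).aestronglyMeasurable.aemeasurable.ennreal_ofReal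
  have hGmono : ∀ᵐ x ∂μ, Monotone (fun N => G N x) := by
    filter_upwards [hanti] with x hx i j hij
    exact ENNReal.ofReal_le_ofReal (by linarith [hx hij])
  have hGint : ∀ N, ∫⁻ x, G N x ∂μ ≤ ENNReal.ofReal (∫ x, F 0 x ∂μ - C) := by
    intro N
    have h0 : 0 ≤ᵐ[μ] fun x => F 0 x - F N x := by
      filter_upwards [hanti] with x hx
      have := hx (Nat.zero_le N)
      simp only [Pi.zero_apply]
      linarith
    have := ofReal_integral_eq_lintegral_ofReal ((hF 0).sub (hF N)) h0
    simp only [Pi.sub_apply] at this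
    rw [← this, integral_sub (hF 0) (hF N)]
    exact ENNReal.ofReal_le_ofReal (by linarith [hC N])
  have hsup : ∫⁻ x, ⨆ N, G N x ∂μ ≤ ENNReal.ofReal (∫ x, F 0 x ∂μ - C) := by
    rw [lintegral_iSup' hGm hGmono]
    exact iSup_le hGint
  have hsupm : AEMeasurable (fun x => ⨆ N, G N x) μ := AEMeasurable.iSup hGm
  have hfin : ∀ᵐ x ∂μ, ⨆ N, G N x < ⊤ :=
    ae_lt_top' hsupm (ne_top_of_le_ne_top ENNReal.ofReal_ne_top hsup)
  have hkey : ∀ᵐ x ∂μ, ∃ t : ℝ, U x = t ∧ Tendsto (fun N => F N x) atTop (𝓝 t) ∧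
      ENNReal.ofReal (F 0 x - t) ≤ ⨆ N, G N x ∧ t ≤ F 0 x := by
    filter_upwards [hfin, hanti, hlim] with x h1 h2 h3
    have hb : BddBelow (range fun N => F N x) := by
      refine ⟨F 0 x - (⨆ N, G N x).toReal, ?_⟩
      rintro _ ⟨N, rfl⟩
      have : G N x ≤ ⨆ N, G N x := le_iSup (fun N => G N x) N
      have h4 := (ENNReal.ofReal_le_iff_le_toReal h1.ne).1 this
      simp only
      linarith
    have ht := tendsto_atTop_ciInf h2 hb
    refine ⟨_, ?_, ht, ?_, ciInf_le hb 0⟩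
    · exact tendsto_nhds_unique h3 ((continuous_coe_real_ereal.tendsto _).comp ht)
    · have : Tendsto (fun N => G N x) atTop (𝓝 (ENNReal.ofReal (F 0 x - ⨅ N, F N x))) :=
        ENNReal.tendsto_ofReal (tendsto_const_nhds.sub ht)
      exact le_of_tendsto' this (fun N => le_iSup (fun N => G N x) N)
  have hconv : ∀ᵐ x ∂μ, Tendsto (fun N => F N x) atTop (𝓝 (U x).toReal) := by
    filter_upwards [hkey] with x ⟨t, h1, h2, _⟩
    rw [h1, EReal.toReal_coe]; exact h2
  have hUm : AEStronglyMeasurable (fun x => (U x).toReal) μ :=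
    aestronglyMeasurable_of_tendsto_ae atTop (fun N => (hF N).aestronglyMeasurable) hconv
  have hdiff : Integrable (fun x => F 0 x - (U x).toReal) μ := by
    refine ⟨(hF 0).aestronglyMeasurable.sub hUm, ?_⟩
    rw [hasFiniteIntegral_iff_ofReal]
    · refine lt_of_le_of_lt (lintegral_mono_ae ?_) (lt_of_le_of_lt hsup ENNReal.ofReal_lt_top)
      filter_upwards [hkey] with x ⟨t, h1, _, h3, _⟩
      rw [h1, EReal.toReal_coe]; exact h3
    · filter_upwards [hkey] with x ⟨t, h1, _, _, h3⟩
      rw [h1, EReal.toReal_coe]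
      simp only [Pi.zero_apply]
      linarith
  have hUi : Integrable (fun x => (U x).toReal) μ := by
    have := (hF 0).sub hdiff
    refine this.congr (Eventually.of_forall fun x => ?_)
    simp
  refine ⟨?_, hUi, ?_⟩
  · filter_upwards [hkey] with x ⟨t, h1, _⟩
    rw [h1]; exact EReal.coe_ne_bot t
  · exact ge_of_tendsto' (integral_tendsto_of_tendsto_of_antitone hF hUi hanti hconv) hC

section assembly
variable {E : Type*} [NormedAddCommGroup E] [NormedSpace ℂ E]

lemma assembly {Ω S : Set E} (hΩ : IsOpen Ω) (hconn : IsPreconnected Ω) {tau : E → ℝ}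
    (htau : ∀ p ∈ Ω, ContinuousAt tau p) {Φ : ℕ → E → ℝ} (hΦ : ∀ n, ∀ p ∈ Ω, GoodAt (Φ n) p)
    (hΦ0 : ∀ n : ℕ, ∀ p ∈ Ω, tau p ≤ n → Φ n p ≤ 0)
    (hS : ∀ p ∈ Ω, p ∈ S → ∀ᶠ n in atTop, Φ n p ≤ -1) {δ : ℕ → ℝ} (hδ : Summable δ)
    (hδ0 : ∀ n, 0 ≤ δ n) (hS' : ∀ p ∈ Ω, p ∉ S → ∀ᶠ n in atTop, - δ n ≤ Φ n p)
    (hne : ∃ p ∈ Ω, p ∉ S) : CompletePluripolarIn S Ω := by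
  set T : ℕ → E → ℝ := fun N p => ∑ n ∈ Finset.range N, Φ n p with hT
  have hTg : ∀ N, ∀ p ∈ Ω, GoodAt (T N) p := fun N p hp =>
    GoodAt.sum _ (fun n _ => hΦ n p hp)
  have hTanti : ∀ p ∈ Ω, ∀ m : ℕ, tau p ≤ m → Antitone (fun N => T (N + m) p) := by
    intro p hp m hm
    refine antitone_nat_of_succ_le fun N => ?_
    have : T (N + 1 + m) p = T (N + m) p + Φ (N + m) p := by
      rw [show N + 1 + m = (N + m) + 1 by ring]
      exact Finset.sum_range_succ _ _
    have h2 := hΦ0 (N + m) p hp (by push_cast; linarith [(Nat.cast_nonneg N : (0:ℝ) ≤ N)])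
    linarith
  set u : E → EReal := fun p => limsup (fun N => (T N p : EReal)) atTop with hu
  have hlim0 : ∀ p ∈ Ω, ∀ m : ℕ, tau p ≤ m →
      Tendsto (fun N => (T (N + m) p : EReal)) atTop (𝓝 (⨅ N, (T (N + m) p : EReal))) := by
    intro p hp m hm
    exact tendsto_atTop_iInf fun i j hij => EReal.coe_le_coe_iff.2 (hTanti p hp m hm hij)
  have hinf : ∀ p ∈ Ω, ∀ m : ℕ, tau p ≤ m → u p = ⨅ N, (T (N + m) p : EReal) := by
    intro p hp m hm
    exact ((tendsto_add_atTop_iff_nat m).1 (hlim0 p hp m hm)).limsup_eq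
  have hlim : ∀ p ∈ Ω, Tendsto (fun N => (T N p : EReal)) atTop (𝓝 (u p)) := by
    intro p hp
    obtain ⟨m, hm⟩ := exists_nat_ge (tau p)
    rw [hinf p hp m hm]
    exact (tendsto_add_atTop_iff_nat m).1 (hlim0 p hp m hm)
  have hbot : ∀ p ∈ Ω, p ∈ S → u p = ⊥ := by
    intro p hp hpS
    rw [EReal.eq_bot_iff_forall_lt]
    intro y
    obtain ⟨M, hM⟩ := eventually_atTop.1 (hS p hp hpS)
    have hk : ∀ k : ℕ, T (M + k) p ≤ T M p - k := by
      intro k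
      induction k with
      | zero => simp
      | succ k ih =>
        have : T (M + (k + 1)) p = T (M + k) p + Φ (M + k) p := Finset.sum_range_succ _ _
        have h2 := hM (M + k) (by omega)
        push_cast
        linarith
    obtain ⟨k0, hk0⟩ := exists_nat_gt (T M p - y + 1)
    have : u p ≤ ((y - 1 : ℝ) : EReal) := by
      refine le_of_tendsto (hlim p hp) ?_
      filter_upwards [eventually_ge_atTop (M + k0)] with N hN
      obtain ⟨j, rfl⟩ := Nat.exists_eq_add_of_le hN
      have := hk (k0 + j)
      rw [← add_assoc] at this
      push_cast at this
      exact EReal.coe_le_coe_iff.2 (by linarith [(Nat.cast_nonneg j : (0:ℝ) ≤ j)])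
    exact lt_of_le_of_lt this (EReal.coe_lt_coe_iff.2 (by linarith))
  have hnbot : ∀ p ∈ Ω, p ∉ S → u p ≠ ⊥ := by
    intro p hp hpS
    obtain ⟨M, hM⟩ := eventually_atTop.1 (hS' p hp hpS)
    have hk : ∀ k : ℕ, T M p - ∑ n ∈ Finset.range (M + k), δ n ≤ T (M + k) p := by
      intro k
      induction k with
      | zero =>
        have := Finset.sum_nonneg (s := Finset.range M) (fun n _ => hδ0 n)
        simpa using this
      | succ k ih =>
        have : T (M + (k + 1)) p = T (M + k) p + Φ (M + k) p := Finset.sum_range_succ _ _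
        have h3 : ∑ n ∈ Finset.range (M + (k + 1)), δ n = ∑ n ∈ Finset.range (M + k), δ n + δ (M + k) :=
          Finset.sum_range_succ _ _
        have h2 := hM (M + k) (by omega)
        linarith
    have : ((T M p - ∑' n, δ n : ℝ) : EReal) ≤ u p := by
      refine ge_of_tendsto (hlim p hp) ?_
      filter_upwards [eventually_ge_atTop M] with N hN
      obtain ⟨j, rfl⟩ := Nat.exists_eq_add_of_le hN
      have h2 := hk j
      have h3 := hδ.sum_le_tsum (Finset.range (M + j)) (fun n _ => hδ0 n)
      exact EReal.coe_le_coe_iff.2 (by linarith)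
    intro h
    rw [h, le_bot_iff] at this
    exact EReal.coe_ne_bot _ this
  refine ⟨u, ⟨?_, ?_, ?_, ?_⟩, fun p hp => ⟨fun h => ?_, hbot p hp⟩⟩
  · intro p hp
    obtain ⟨m, hm⟩ := exists_nat_ge (tau p)
    rw [hinf p hp m hm]
    exact ne_top_of_le_ne_top (EReal.coe_ne_top _) (iInf_le _ 0)
  · intro p hp
    refine UpperSemicontinuousAt.upperSemicontinuousWithinAt _ ?_
    obtain ⟨m, hm⟩ := exists_nat_gt (tau p)
    rw [upperSemicontinuousAt_iff]
    intro y hy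
    rw [hinf p hp m hm.le, iInf_lt_iff] at hy
    obtain ⟨N, hN⟩ := hy
    obtain ⟨t, ht1, ht2⟩ := EReal.lt_iff_exists_real_btwn.1 hN
    have h1 := upperSemicontinuousAt_iff.1 (hTg (N + m) p hp).usc t (EReal.coe_lt_coe_iff.1 ht1)
    filter_upwards [h1, hΩ.mem_nhds hp, (htau p hp).eventually (gt_mem_nhds hm)] with x hx1 hx2 hx3
    rw [hinf x hx2 m hx3.le]
    exact lt_of_le_of_lt (iInf_le _ N) ((EReal.coe_lt_coe_iff.2 hx1).trans ht2)
  · intro z hz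
    obtain ⟨p, hp, hpS⟩ := hne
    exact ⟨p, by rw [hconn.connectedComponentIn hz]; exact hp, hnbot p hp hpS⟩
  · intro a b c r hr hsub
    have hcont : ContinuousOn (fun l : ℂ => tau (a + l • b)) (closedBall c r) := by
      intro l hl
      have h1 : ContinuousAt (fun l : ℂ => a + l • b) l := by fun_prop
      exact (ContinuousAt.comp (f := fun l : ℂ => a + l • b) (htau _ (hsub l hl)) h1).continuousWithinAt
    obtain ⟨C, hC⟩ := (isCompact_closedBall c r).bddAbove_image hcont
    obtain ⟨m, hm⟩ := exists_nat_ge C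
    have hbd : ∀ l ∈ closedBall c r, tau (a + l • b) ≤ m := fun l hl =>
      (hC (mem_image_of_mem _ hl)).trans hm
    by_cases hb : u (a + c • b) = ⊥
    · rw [hb]; exact bot_le
    have hcc : c ∈ closedBall c r := mem_closedBall_self hr.le
    have hsph : ∀ θ, circleMap c r θ ∈ closedBall c r := fun θ =>
      sphere_subset_closedBall (circleMap_mem_sphere c hr.le θ)
    have hutop : u (a + c • b) ≠ ⊤ := by
      rw [hinf _ (hsub c hcc) m (hbd c hcc)]
      exact ne_top_of_le_ne_top (EReal.coe_ne_top _) (iInf_le _ 0)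
    have hx : ((u (a + c • b)).toReal : EReal) = u (a + c • b) := EReal.coe_toReal hutop hb
    set x := (u (a + c • b)).toReal with hxdef
    have hlg : ∀ N, CircleIntegrable (fun l : ℂ => T (N + m) (a + l • b)) c r ∧
        T (N + m) (a + c • b) ≤ Real.circleAverage (fun l : ℂ => T (N + m) (a + l • b)) c r :=
      fun N => local_to_global hr (fun l hl => (hTg _ _ (hsub l hl)).comp_line)
    have hpi : 0 < 2 * Real.pi := by positivity
    obtain ⟨h1, h2, h3⟩ := antitone_conv (μ := volume.restrict (Ioc 0 (2 * Real.pi)))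
      (F := fun N θ => T (N + m) (a + circleMap c r θ • b))
      (U := fun θ => u (a + circleMap c r θ • b)) (C := 2 * Real.pi * x)
      (fun N => (intervalIntegrable_iff_integrableOn_Ioc_of_le hpi.le).1 (hlg N).1)
      (Eventually.of_forall fun θ => hTanti _ (hsub _ (hsph θ)) m (hbd _ (hsph θ)))
      (Eventually.of_forall fun θ => by
        rw [hinf _ (hsub _ (hsph θ)) m (hbd _ (hsph θ))]
        exact hlim0 _ (hsub _ (hsph θ)) m (hbd _ (hsph θ)))
      (fun N => by
        have h4 := (hlg N).2
        have h5 : x ≤ T (N + m) (a + c • b) := by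
          rw [← EReal.coe_le_coe_iff, hx, hinf _ (hsub c hcc) m (hbd c hcc)]
          exact iInf_le _ N
        rw [Real.circleAverage, intervalIntegral.integral_of_le hpi.le, smul_eq_mul,
          le_inv_mul_iff₀ hpi] at h4
        refine le_trans ?_ h4
        exact mul_le_mul_of_nonneg_left h5 hpi.le)
    rw [circleAvg, if_pos ⟨(intervalIntegrable_iff_integrableOn_Ioc_of_le hpi.le).2 h2, h1⟩, ← hx,
      EReal.coe_le_coe_iff, le_div_iff₀ hpi, intervalIntegral.integral_of_le hpi.le]
    linarith
  · by_contra hpS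
    exact hnbot p hp hpS h

end assembly

lemma eventually_exh {U : Set ℂ} {z : ℂ} (hz : z ∈ U) :
    ∀ᶠ n : ℕ in atTop, z ∈ exh U ((n : ℝ) + 1) := by
  have h := tendsto_natCast_atTop_atTop (R := ℝ)
  filter_upwards [h.eventually (eventually_ge_atTop ‖z‖), h.eventually (eventually_ge_atTop (ee U z))]
    with n h1 h2
  exact ⟨hz, by linarith, by linarith⟩

/-- If moreover `f` does not extend holomorphically to any point of `A`,
then `Γ_f ∪ (A' × ℂ)` is complete pluripolar in `D × ℂ`, where `A'` is the set of
accumulation points of `A` lying in `D`. -/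
theorem statement1 (D A : Set ℂ) (f : ℂ → ℂ)
    (hD : IsOpen D) (hDconn : IsConnected D)
    (hAD : A ⊆ D) (hAclosed : ∀ z ∈ D, z ∈ closure A → z ∈ A)
    (hApolar : PolarSet A)
    (hf : DifferentiableOn ℂ f (D \ A))
    (hnoext : ∀ a ∈ A, ¬ ∃ (V : Set ℂ) (g : ℂ → ℂ), IsOpen V ∧ a ∈ V ∧ V ⊆ D ∧
      DifferentiableOn ℂ g V ∧ Set.EqOn f g (V \ A)) :
    CompletePluripolarIn
      (graphOver f (D \ A) ∪ {z ∈ D | z ∈ closure (A \ {z})} ×ˢ (Set.univ : Set ℂ))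
      (D ×ˢ (Set.univ : Set ℂ)) := by
  set B : Set ℂ := {z ∈ D | z ∈ closure (A \ {z})} with hB
  have hacc : ∀ z, z ∈ closure (A \ {z}) ↔ AccPt z (𝓟 A) := fun z => by
    rw [accPt_principal_iff_clusterPt, mem_closure_iff_clusterPt]
  have hBA : B ⊆ A := fun z hz => hAclosed z hz.1 (closure_mono sdiff_subset hz.2)
  have hBclosed : ∀ z ∈ D, z ∈ closure B → z ∈ B := by
    intro z hz hzB
    refine ⟨hz, (hacc z).2 ?_⟩
    have h1 : B ⊆ derivedSet A := fun y hy => (hacc y).1 hy.2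
    exact closure_minimal h1 (isClosed_derivedSet A) hzB
  have hDB := isOpen_diff_of hD hBclosed
  have hfin : ∀ n : ℕ, (A ∩ exh (D \ B) ((n : ℝ) + 1)).Finite := by
    intro n
    by_contra hinf
    obtain ⟨x, hx, hxa⟩ := Set.Infinite.exists_accPt_of_subset_isCompact hinf
      (isCompact_exh hDB (by positivity : (0:ℝ) < (n : ℝ) + 1)) inter_subset_right
    exact hx.1.2 ⟨hx.1.1, (hacc x).2 (hxa.mono (principal_mono.2 inter_subset_left))⟩
  have hex := fun n : ℕ => main3 (n := (n : ℝ) + 1) (ε := 1 / 4 * (1 / 2) ^ n) hD hAclosed hApolar hf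
    hBA hAD hnoext (by linarith [(Nat.cast_nonneg n : (0:ℝ) ≤ n)]) (by positivity)
    (by
      have : (1 / 2 : ℝ) ^ n ≤ 1 := pow_le_one₀ (by norm_num) (by norm_num)
      linarith) (hfin n).toFinset
    (by
      intro a ha
      rw [Set.Finite.mem_toFinset] at ha
      exact ⟨ha.1, fun h => ha.2.1.2 ⟨ha.2.1.1, h⟩, ha.2.1.2⟩)
  choose Φ h1 h2 h3 h4 h5 h6 using hex
  have htend := tendsto_natCast_atTop_atTop (R := ℝ)
  have htau : ∀ p : ℂ × ℂ, ∀ᶠ n : ℕ in atTop, tau D p ≤ (n : ℝ) + 1 := by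
    intro p
    filter_upwards [htend.eventually (eventually_ge_atTop (tau D p))] with n hn
    linarith
  refine assembly (hD.prod isOpen_univ) (hDconn.isPreconnected.prod isPreconnected_univ)
    (tau := tau D) (fun p hp => continuousAt_tau hD hp.1) (Φ := Φ) (fun n p hp => h1 n p hp.1)
    (fun n p hp ht => h2 n p hp.1 (by linarith)) ?_ (δ := fun n => (1 / 2 : ℝ) ^ n)
    (summable_geometric_of_lt_one (by norm_num) (by norm_num)) (fun n => by positivity) ?_ ?_
  · rintro ⟨z, w⟩ hp hS
    rcases hS with ⟨hz, hw⟩ | hz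
    · filter_upwards [htau (z, w), eventually_exh hz] with n ht hn
      exact h3 n z w hn ht hw
    · filter_upwards [htau (z, w)] with n ht
      exact h4 n z w hz.1 ht
  · rintro ⟨z, w⟩ hp hS
    have hzD : z ∈ D := hp.1
    have hzB : z ∉ B := fun h => hS (Or.inr ⟨h, mem_univ _⟩)
    by_cases hzA : z ∈ A
    · filter_upwards [htau (z, w), eventually_exh (U := D \ B) ⟨hzD, hzB⟩] with n ht hn
      have := h6 n z ((hfin n).mem_toFinset.2 ⟨hzA, hn⟩) w ht
      linarith
    · have hw : w ≠ f z := fun h => hS (Or.inl ⟨⟨hzD, hzA⟩, h⟩)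
      have hpos : 0 < ‖w - f z‖ := norm_pos_iff.2 (sub_ne_zero.2 hw)
      filter_upwards [htau (z, w), eventually_exh (U := D \ A) ⟨hzD, hzA⟩,
        htend.eventually (eventually_ge_atTop (‖w - f z‖⁻¹))] with n ht hn hi
      have := h5 n z w hn ht (inv_le_of_inv_le₀ hpos (by linarith))
      linarith
  · have hne : ∃ z ∈ D, z ∉ A := by
      by_contra! hcon
      obtain ⟨z, hz⟩ := hDconn.nonempty
      exact hnoext z (hcon z hz) ⟨D, fun _ => 0, hD, hz, Subset.rfl,
        differentiableOn_const 0, fun y hy => absurd (hcon y hy.1) hy.2⟩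
    obtain ⟨z, hz, hzA⟩ := hne
    refine ⟨(z, f z + 1), ⟨hz, mem_univ _⟩, ?_⟩
    rintro (⟨_, h⟩ | h)
    · simp at h
    · exact hzA (hBA h.1)
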